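/- arXiv:1611.00729 — 12 statements merged into one kernel-verified Lean document; each statement's English description precedes it below -/
import Mathlib

section
/- Let μ > 0. For every F ∈ ℝ^{3×3} with det F = 1, the incompressible neo-Hookean energy satisfies W_nH(F) ≥ (μ/2)·dist²(F, SO(3)); that is, (μ/2)(|F|² − 3) ≥ (μ/2)·inf{ |F − R|² : R ∈ SO(3) }. -/
open Matrix

noncomputable section

/-- Squared Frobenius norm of a matrix. -/
def frob2 {m n : Type*} [Fintype m] [Fintype n] (A : Matrix m n ℝ) : ℝ :=
  ∑ i, ∑ j, (A i j) ^ 2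

/-- `R ∈ SO(3)`: `RᵀR = I₃` and `det R = 1`. -/
def SO3 (R : Matrix (Fin 3) (Fin 3) ℝ) : Prop := Rᵀ * R = 1 ∧ R.det = 1

/-- The matrix with columns `p`, `q × p`, `q`. -/
def crossFrame (p q : Fin 3 → ℝ) : Matrix (Fin 3) (Fin 3) ℝ :=
  !![p 0, q 1 * p 2 - q 2 * p 1, q 0;
     p 1, q 2 * p 0 - q 0 * p 2, q 1;
     p 2, q 0 * p 1 - q 1 * p 0, q 2]

lemma so3_crossFrame {p q : Fin 3 → ℝ} (hp : p 0 ^ 2 + p 1 ^ 2 + p 2 ^ 2 = 1)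
    (hq : q 0 ^ 2 + q 1 ^ 2 + q 2 ^ 2 = 1) (hpq : p 0 * q 0 + p 1 * q 1 + p 2 * q 2 = 0) :
    SO3 (crossFrame p q) := by
  have hlagrange : (p 0 ^ 2 + p 1 ^ 2 + p 2 ^ 2) * (q 0 ^ 2 + q 1 ^ 2 + q 2 ^ 2)
      - (p 0 * q 0 + p 1 * q 1 + p 2 * q 2) ^ 2 = 1 := by
    rw [hp, hq, hpq]; norm_num
  constructor
  · ext i j
    fin_cases i <;> fin_cases j <;>
      simp [crossFrame, Matrix.mul_apply, Fin.sum_univ_three] <;> linarith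
  · simp only [crossFrame, Matrix.det_fin_three, Matrix.of_apply, Matrix.cons_val]
    linarith

lemma frob2_sub_of_so3 (F : Matrix (Fin 3) (Fin 3) ℝ) {R : Matrix (Fin 3) (Fin 3) ℝ}
    (hR : SO3 R) : frob2 (F - R) = frob2 F - 2 * (Rᵀ * F).trace + 3 := by
  have h : (Rᵀ * R).trace = 3 := by rw [hR.1]; simp
  simp only [frob2, Matrix.trace, Matrix.diag, Matrix.mul_apply, Matrix.transpose_apply,
    Matrix.sub_apply, Fin.sum_univ_three] at h ⊢
  linarith

lemma three_le_add_of_mul_eq_one {x y z : ℝ} (hx : 0 < x) (hy : 0 < y) (hz : 0 < z)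
    (h : x * y * z = 1) : 3 ≤ x + y + z := by
  have h27 : 27 * (x * y * z) ≤ (x + y + z) ^ 3 := by
    nlinarith [mul_nonneg hx.le (sq_nonneg (y - z)), mul_nonneg hy.le (sq_nonneg (x - z)),
      mul_nonneg hz.le (sq_nonneg (x - y)), mul_nonneg hx.le (sq_nonneg (x - y)),
      mul_nonneg hx.le (sq_nonneg (x - z)), mul_nonneg hy.le (sq_nonneg (x - y)),
      mul_nonneg hy.le (sq_nonneg (y - z)), mul_nonneg hz.le (sq_nonneg (x - z)),
      mul_nonneg hz.le (sq_nonneg (y - z))]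
  refine le_of_pow_le_pow_left₀ (n := 3) (by norm_num) (by positivity) ?_
  linarith

lemma exists_normalize {v : Fin 3 → ℝ} (hv : v ≠ 0) :
    ∃ x > 0, ∃ p : Fin 3 → ℝ, (∀ i, v i = x * p i) ∧ p 0 ^ 2 + p 1 ^ 2 + p 2 ^ 2 = 1 := by
  have hpos : 0 < v 0 ^ 2 + v 1 ^ 2 + v 2 ^ 2 := by
    obtain ⟨i, hi⟩ := Function.ne_iff.mp hv
    have : 0 < v i ^ 2 := by simpa [sq_pos_iff] using hi
    fin_cases i <;> simp at this <;> positivity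
  have hx := Real.sqrt_pos.mpr hpos
  refine ⟨_, hx, fun i => v i / √(v 0 ^ 2 + v 1 ^ 2 + v 2 ^ 2), fun i => ?_, ?_⟩
  · field_simp
  · simp only [div_pow, Real.sq_sqrt hpos.le]
    field_simp

/-- Gram–Schmidt on the columns of `F` yields `R ∈ SO(3)` such that `RᵀF` is triangular with
positive diagonal and determinant one, so that its trace is at least three. -/
lemma exists_so3_three_le_trace {F : Matrix (Fin 3) (Fin 3) ℝ} (hF : F.det = 1) :
    ∃ R, SO3 R ∧ 3 ≤ (Rᵀ * F).trace := by
  rw [Matrix.det_fin_three] at hF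
  have ha : (fun i => F i 0) ≠ 0 := by
    intro h
    have h0 := congrFun h 0
    have h1 := congrFun h 1
    have h2 := congrFun h 2
    simp only [Pi.zero_apply] at h0 h1 h2
    simp [h0, h1, h2] at hF
  obtain ⟨x, hx, p, hp, hp1⟩ := exists_normalize ha
  have hn : ![F 1 0 * F 2 1 - F 2 0 * F 1 1, F 2 0 * F 0 1 - F 0 0 * F 2 1,
      F 0 0 * F 1 1 - F 1 0 * F 0 1] ≠ 0 := by
    intro h
    have h0 := congrFun h 0
    have h1 := congrFun h 1
    have h2 := congrFun h 2
    simp only [Pi.zero_apply, Matrix.cons_val] at h0 h1 h2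
    have : (0 : ℝ) = 1 := by
      linear_combination hF - F 0 2 * h0 - F 1 2 * h1 - F 2 2 * h2
    norm_num at this
  obtain ⟨y, hy, q, hq, hq1⟩ := exists_normalize hn
  have q0 := hq 0
  have q1 := hq 1
  have q2 := hq 2
  simp only [Matrix.cons_val] at q0 q1 q2
  have hpq : p 0 * q 0 + p 1 * q 1 + p 2 * q 2 = 0 := by
    have : y * (p 0 * q 0 + p 1 * q 1 + p 2 * q 2) = 0 := by
      simp only [hp] at q0 q1 q2
      linear_combination -p 0 * q0 - p 1 * q1 - p 2 * q2
    exact (mul_eq_zero.mp this).resolve_left hy.ne'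
  have hR := so3_crossFrame hp1 hq1 hpq
  refine ⟨_, hR, ?_⟩
  have hdiag₀ : p 0 * F 0 0 + p 1 * F 1 0 + p 2 * F 2 0 = x := by
    rw [hp 0, hp 1, hp 2]; linear_combination x * hp1
  have hdiag₁ : (q 1 * p 2 - q 2 * p 1) * F 0 1 + (q 2 * p 0 - q 0 * p 2) * F 1 1
      + (q 0 * p 1 - q 1 * p 0) * F 2 1 = y / x := by
    simp only [hp] at q0 q1 q2
    rw [eq_div_iff hx.ne']
    linear_combination q 0 * q0 + q 1 * q1 + q 2 * q2 + y * hq1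
  have hdiag₂ : q 0 * F 0 2 + q 1 * F 1 2 + q 2 * F 2 2 = 1 / y := by
    rw [eq_div_iff hy.ne']
    linear_combination hF - F 0 2 * q0 - F 1 2 * q1 - F 2 2 * q2
  have htrace : ((crossFrame p q)ᵀ * F).trace = x + y / x + 1 / y := by
    rw [← hdiag₁, ← hdiag₂, ← hdiag₀]
    simp [crossFrame, Matrix.trace, Matrix.mul_apply, Fin.sum_univ_three]
  rw [htrace]
  exact three_le_add_of_mul_eq_one hx (by positivity) (by positivity) (by field_simp)

/-- for `μ > 0` and `F` with `det F = 1`,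
`(μ/2)(|F|² - 3) ≥ (μ/2) · inf{ |F - R|² : R ∈ SO(3) }`. -/
theorem statement1 (μ : ℝ) (hμ : 0 < μ) (F : Matrix (Fin 3) (Fin 3) ℝ) (hF : F.det = 1) :
    μ / 2 * (frob2 F - 3) ≥ μ / 2 * sInf {d : ℝ | ∃ R, SO3 R ∧ d = frob2 (F - R)} := by
  obtain ⟨R, hR, htr⟩ := exists_so3_three_le_trace hF
  have hbdd : BddBelow {d : ℝ | ∃ R, SO3 R ∧ d = frob2 (F - R)} := by
    refine ⟨0, ?_⟩
    rintro _ ⟨R, -, rfl⟩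
    unfold frob2
    positivity
  have hle := csInf_le hbdd ⟨R, hR, rfl⟩
  rw [frob2_sub_of_so3 F hR] at hle
  exact mul_le_mul_of_nonneg_left (by linarith) (by positivity)
end
end

section
/- There exists a universal constant C > 0 such that for every G ∈ ℝ^{3×3} with det(I₃ + G) = 1 one has |I₃ + G|² − 3 ≤ C(|G|² + |G|³); equivalently, W_nH(I₃ + G) ≤ (μ/2)·C(|G|² + |G|³) for any μ > 0. -/
open Matrix

noncomputable section

/-- Expansion of the squared Frobenius norm around the identity. -/
theorem frob2_one_add {n : Type*} [Fintype n] [DecidableEq n] (G : Matrix n n ℝ) :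
    frob2 (1 + G) = frob2 G + 2 * G.trace + Fintype.card n := by
  have h (i j : n) : ((1 + G) i j) ^ 2 = G i j ^ 2 + if i = j then 2 * G i j + 1 else 0 := by
    rw [Matrix.add_apply, one_apply]
    split_ifs <;> ring
  simp only [frob2, h]
  simp [Finset.sum_add_distrib, Matrix.trace, Finset.mul_sum]
  ring

theorem frob2_nonneg {m n : Type*} [Fintype m] [Fintype n] (A : Matrix m n ℝ) : 0 ≤ frob2 A :=
  Finset.sum_nonneg fun _ _ => Finset.sum_nonneg fun _ _ => sq_nonneg _

/-- Each entry of a matrix is bounded by the Frobenius norm. -/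
theorem abs_apply_le_sqrt_frob2 {m n : Type*} [Fintype m] [Fintype n] (A : Matrix m n ℝ)
    (i : m) (j : n) : |A i j| ≤ √(frob2 A) := by
  refine Real.abs_le_sqrt ?_
  calc A i j ^ 2 ≤ ∑ j, A i j ^ 2 :=
        Finset.single_le_sum (f := fun j => A i j ^ 2) (fun _ _ => sq_nonneg _)
          (Finset.mem_univ j)
    _ ≤ frob2 A :=
        Finset.single_le_sum (f := fun i => ∑ j, A i j ^ 2)
          (fun _ _ => Finset.sum_nonneg fun _ _ => sq_nonneg _) (Finset.mem_univ i)

theorem abs_det_le_factorial_mul_sqrt_frob2_pow {n : Type*} [Fintype n] [DecidableEq n]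
    (A : Matrix n n ℝ) :
    |A.det| ≤ (Fintype.card n).factorial * √(frob2 A) ^ Fintype.card n := by
  simpa using Matrix.det_le (A := A) (abv := AbsoluteValue.abs) (abs_apply_le_sqrt_frob2 A)

/-- If `1 + G` is unimodular, then the trace of `G` is at most `|G|² - det G`. -/
theorem trace_le_frob2_sub_det {G : Matrix (Fin 3) (Fin 3) ℝ} (h : (1 + G).det = 1) :
    G.trace ≤ frob2 G - G.det := by
  simp [det_fin_three] at h
  simp only [frob2, Matrix.trace, det_fin_three, Fin.sum_univ_three, diag_apply]
  nlinarith [sq_nonneg (G 0 0 + G 1 1), sq_nonneg (G 0 0 + G 2 2), sq_nonneg (G 1 1 + G 2 2),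
    sq_nonneg (G 0 1 - G 1 0), sq_nonneg (G 0 2 - G 2 0), sq_nonneg (G 1 2 - G 2 1)]

/-- there is a universal constant `C > 0` such that for every
`G ∈ ℝ^{3×3}` with `det(I₃ + G) = 1` one has `|I₃+G|² - 3 ≤ C(|G|² + |G|³)`;
equivalently `W_nH(I₃+G) = (μ/2)(|I₃+G|²-3) ≤ (μ/2)·C(|G|² + |G|³)` for any `μ > 0`.
Here `|G| = √(frob2 G)` is the Frobenius norm. -/
theorem statement2 :
    ∃ C : ℝ, 0 < C ∧ ∀ G : Matrix (Fin 3) (Fin 3) ℝ, (1 + G).det = 1 →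
      frob2 (1 + G) - 3 ≤ C * (frob2 G + Real.sqrt (frob2 G) ^ 3) ∧
      ∀ μ : ℝ, 0 < μ →
        μ / 2 * (frob2 (1 + G) - 3) ≤ μ / 2 * (C * (frob2 G + Real.sqrt (frob2 G) ^ 3)) := by
  refine ⟨12, by norm_num, fun G hG => ?_⟩
  have key : frob2 (1 + G) - 3 ≤ 12 * (frob2 G + √(frob2 G) ^ 3) := by
    have hdet := neg_le_of_abs_le (abs_det_le_factorial_mul_sqrt_frob2_pow G)
    have hfrob := frob2_one_add G
    norm_num [Nat.factorial] at hdet hfrob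
    linarith [trace_le_frob2_sub_det hG, frob2_nonneg G]
  exact ⟨key, fun μ hμ => mul_le_mul_of_nonneg_left key (by positivity)⟩
end
end

section
/- Let r_f ≥ 1, r_0 ≥ 1, set r := r_f/r_0, let μ > 0, let ν₀ ∈ ℝ³ be a unit vector, and let F ∈ ℝ^{3×3} with Fν₀ ≠ 0. Then [det F = 1 and W^e(F, Fν₀/|Fν₀|, ν₀) = 0] holds if and only if [det F = 1 and FᵀF = ℓ_{ν₀}], where ℓ_{ν₀} := r^{−1/3}(I₃ + (r−1) ν₀⊗ν₀). Moreover, if these conditions hold, then the matrix R := F·ℓ_{ν₀}^{−1/2}, where ℓ_{ν₀}^{−1/2} = r^{1/6}(I₃ + (r^{−1/2}−1) ν₀⊗ν₀), belongs to SO(3) and Fν₀/|Fν₀| = Rν₀ (R is the unique rotation in the polar decomposition of F). -/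
open Matrix

noncomputable section

/-- `v` is a unit vector in `ℝ³`. -/
def unit3 (v : Fin 3 → ℝ) : Prop := ∑ i, (v i) ^ 2 = 1

/-- Outer product `u ⊗ v` of vectors in `ℝ³`. -/
def outer3 (u v : Fin 3 → ℝ) : Matrix (Fin 3) (Fin 3) ℝ := Matrix.of fun i j => u i * v j

/-- Step-length tensor `ℓ_ν = r^{-1/3}(I₃ + (r-1) ν ⊗ ν)` with anisotropy parameter `r`. -/
def ell (r : ℝ) (v : Fin 3 → ℝ) : Matrix (Fin 3) (Fin 3) ℝ :=
  r ^ (-(1/3) : ℝ) • (1 + (r - 1) • outer3 v v)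

/-- The inverse square root `ℓ_ν^{-1/2} = r^{1/6}(I₃ + (r^{-1/2}-1) ν ⊗ ν)`. -/
def ellInvSqrt (r : ℝ) (v : Fin 3 → ℝ) : Matrix (Fin 3) (Fin 3) ℝ :=
  r ^ ((1/6) : ℝ) • (1 + (r ^ (-(1/2) : ℝ) - 1) • outer3 v v)

/-- Entropic energy density (finite branch). -/
def We (μ rf r0 : ℝ) (F : Matrix (Fin 3) (Fin 3) ℝ) (ν ν₀ : Fin 3 → ℝ) : ℝ :=
  μ / 2 * (Matrix.trace (Fᵀ * (ell rf ν)⁻¹ * F * ell r0 ν₀) - 3)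

/-- Normalization `v / |v|` of a vector in `ℝ³`. -/
def nvec (v : Fin 3 → ℝ) : Fin 3 → ℝ := fun i => v i / Real.sqrt (∑ j, (v j) ^ 2)

theorem unit3.dotProduct_self {v : Fin 3 → ℝ} (hv : unit3 v) : v ⬝ᵥ v = 1 := by
  simpa [unit3, dotProduct, sq] using hv

theorem outer3_transpose (v : Fin 3 → ℝ) : (outer3 v v)ᵀ = outer3 v v :=
  transpose_vecMulVec v v

theorem outer3_mulVec (v w : Fin 3 → ℝ) : outer3 v v *ᵥ w = (v ⬝ᵥ w) • v := by
  ext i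
  simp only [outer3, mulVec, dotProduct, Matrix.of_apply, Pi.smul_apply, smul_eq_mul,
    Fin.sum_univ_three]
  ring

theorem unit3.outer3_mul_self {v : Fin 3 → ℝ} (hv : unit3 v) :
    outer3 v v * outer3 v v = outer3 v v := by
  have h := vecMulVec_mul_vecMulVec v v v v
  rw [hv.dotProduct_self, one_smul] at h
  exact h

theorem outer3_smul (c : ℝ) (v : Fin 3 → ℝ) :
    outer3 (c • v) (c • v) = (c ^ 2) • outer3 v v := by
  ext i j
  simp only [outer3, Matrix.of_apply, Matrix.smul_apply, Pi.smul_apply, smul_eq_mul]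
  ring

theorem transpose_mul_outer3_mul (F : Matrix (Fin 3) (Fin 3) ℝ) (w : Fin 3 → ℝ) :
    Fᵀ * outer3 w w * F = outer3 (Fᵀ *ᵥ w) (Fᵀ *ᵥ w) := by
  change Fᵀ * vecMulVec w w * F = vecMulVec _ _
  rw [mul_vecMulVec, vecMulVec_mul, mulVec_transpose]

/-- Matrices `a (I + (b - 1) v ⊗ v)` multiply by multiplying both parameters. -/
theorem unit3.uniaxial_mul {v : Fin 3 → ℝ} (hv : unit3 v) (a b c d : ℝ) :
    (a • (1 + (b - 1) • outer3 v v)) * (c • (1 + (d - 1) • outer3 v v)) =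
      (a * c) • (1 + (b * d - 1) • outer3 v v) := by
  simp only [Matrix.smul_mul, Matrix.mul_smul, Matrix.add_mul, Matrix.mul_add, Matrix.one_mul,
    Matrix.mul_one, hv.outer3_mul_self]
  module

theorem unit3.uniaxial_mulVec {v : Fin 3 → ℝ} (hv : unit3 v) (a b : ℝ) :
    (a • (1 + (b - 1) • outer3 v v)) *ᵥ v = (a * b) • v := by
  rw [smul_mulVec, add_mulVec, smul_mulVec, one_mulVec, outer3_mulVec, hv.dotProduct_self]
  module

theorem unit3.ellInvSqrt_mul_self {v : Fin 3 → ℝ} (hv : unit3 v) {r : ℝ} (hr : 0 < r) :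
    ellInvSqrt r v * ellInvSqrt r v = ell r⁻¹ v := by
  rw [ellInvSqrt, ell, hv.uniaxial_mul, ← Real.rpow_add hr, ← Real.rpow_add hr,
    Real.inv_rpow hr.le, ← Real.rpow_neg hr.le, ← Real.rpow_neg_one r]
  norm_num

theorem unit3.ell_mul_ell_inv {v : Fin 3 → ℝ} (hv : unit3 v) {r : ℝ} (hr : 0 < r) :
    ell r v * ell r⁻¹ v = 1 := by
  rw [ell, ell, hv.uniaxial_mul, ← Real.mul_rpow hr.le (inv_nonneg.2 hr.le),
    mul_inv_cancel₀ hr.ne']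
  simp

theorem unit3.ellInvSqrt_mul_ellInvSqrt_inv {v : Fin 3 → ℝ} (hv : unit3 v) {r : ℝ} (hr : 0 < r) :
    ellInvSqrt r v * ellInvSqrt r⁻¹ v = 1 := by
  rw [ellInvSqrt, ellInvSqrt, hv.uniaxial_mul, ← Real.mul_rpow hr.le (inv_nonneg.2 hr.le),
    ← Real.mul_rpow hr.le (inv_nonneg.2 hr.le), mul_inv_cancel₀ hr.ne']
  simp

theorem ellInvSqrt_transpose (r : ℝ) (v : Fin 3 → ℝ) : (ellInvSqrt r v)ᵀ = ellInvSqrt r v := by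
  simp [ellInvSqrt, outer3_transpose]

theorem unit3.det_ellInvSqrt {v : Fin 3 → ℝ} (hv : unit3 v) {r : ℝ} (hr : 0 < r) :
    (ellInvSqrt r v).det = 1 := by
  have h : (1 + (r ^ (-(1/2) : ℝ) - 1) • outer3 v v).det = r ^ (-(1/2) : ℝ) := by
    have hv' := hv
    simp only [unit3, Fin.sum_univ_three] at hv'
    simp only [det_fin_three, Matrix.add_apply, Matrix.smul_apply, outer3, Matrix.of_apply,
      smul_eq_mul, Matrix.one_apply, Fin.reduceEq, if_true, if_false]
    linear_combination (r ^ (-(1/2) : ℝ) - 1) * hv'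
  rw [ellInvSqrt, det_smul, h, Fintype.card_fin, ← Real.rpow_natCast, ← Real.rpow_mul hr.le,
    ← Real.rpow_add hr]
  norm_num

theorem unit3_nvec {w : Fin 3 → ℝ} (hw : w ≠ 0) : unit3 (nvec w) := by
  have h0 : 0 < ∑ j, w j ^ 2 := by
    obtain ⟨i, hi⟩ := Function.ne_iff.1 hw
    exact Finset.sum_pos' (fun j _ => sq_nonneg _) ⟨i, Finset.mem_univ _, sq_pos_iff.2 hi⟩
  simp only [unit3, nvec, div_pow, Real.sq_sqrt h0.le, ← Finset.sum_div]
  exact div_self h0.ne'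

theorem nvec_eq_smul (w : Fin 3 → ℝ) : nvec w = (√(w ⬝ᵥ w))⁻¹ • w := by
  ext i
  simp only [nvec, dotProduct, Pi.smul_apply, smul_eq_mul, ← sq]
  ring

theorem outer3_nvec (w : Fin 3 → ℝ) :
    outer3 (nvec w) (nvec w) = (w ⬝ᵥ w)⁻¹ • outer3 w w := by
  rw [nvec_eq_smul, outer3_smul, inv_pow, Real.sq_sqrt (show 0 ≤ w ⬝ᵥ w from
    Finset.sum_nonneg fun i _ => mul_self_nonneg (w i))]

/-- Equality case of the arithmetic-geometric mean inequality for three numbers. -/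
theorem eq_one_of_add_eq_three_of_mul_eq_one {x y z : ℝ} (hx : 0 ≤ x) (hy : 0 ≤ y) (hz : 0 ≤ z)
    (hs : x + y + z = 3) (hp : x * y * z = 1) : x = 1 ∧ y = 1 ∧ z = 1 := by
  have key : ∀ a b c : ℝ, 0 ≤ a → 0 ≤ b → 0 ≤ c → a + b + c = 3 → a * b * c = 1 → a = 1 := by
    intro a b c ha hb hc hs hp
    have h : (a - 1) ^ 2 * (4 - a) + a * (b - c) ^ 2 = 0 := by
      obtain rfl : c = 3 - a - b := by linarith
      linear_combination -4 * hp
    have h1 : 0 ≤ (a - 1) ^ 2 * (3 - a) := mul_nonneg (sq_nonneg _) (by linarith)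
    have h2 : 0 ≤ a * (b - c) ^ 2 := mul_nonneg ha (sq_nonneg _)
    have h3 : (a - 1) ^ 2 = 0 := le_antisymm (by linarith) (sq_nonneg _)
    linarith [pow_eq_zero_iff two_ne_zero |>.1 h3]
  exact ⟨key x y z hx hy hz hs hp, key y z x hy hz hx (by linarith) (by linarith),
    key z x y hz hx hy (by linarith) (by linarith)⟩

/-- Equality case of `tr (Gᵀ G) ≥ 3` for unimodular `G`. -/
theorem transpose_mul_self_eq_one {G : Matrix (Fin 3) (Fin 3) ℝ} (hdet : G.det = 1)
    (htr : (Gᵀ * G).trace = 3) : Gᵀ * G = 1 := by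
  have hpsd : (Gᵀ * G).PosSemidef := by
    simpa [conjTranspose_eq_transpose_of_trivial] using posSemidef_conjTranspose_mul_self G
  have hs := hpsd.1.trace_eq_sum_eigenvalues
  have hp := hpsd.1.det_eq_prod_eigenvalues
  rw [htr, Fin.sum_univ_three] at hs
  rw [det_mul, det_transpose, hdet, Fin.prod_univ_three] at hp
  obtain ⟨h0, h1, h2⟩ := eq_one_of_add_eq_three_of_mul_eq_one (hpsd.eigenvalues_nonneg 0)
    (hpsd.eigenvalues_nonneg 1) (hpsd.eigenvalues_nonneg 2)
    (by simpa using hs.symm) (by simpa using hp.symm)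
  have he : hpsd.1.eigenvalues = fun _ => 1 := by
    ext i
    fin_cases i <;> assumption
  have hsp := hpsd.1.spectral_theorem
  rw [he] at hsp
  rw [hsp]
  have : diagonal (RCLike.ofReal ∘ fun _ : Fin 3 => (1 : ℝ)) = (1 : Matrix (Fin 3) (Fin 3) ℝ) := by
    ext i j; simp [diagonal, Matrix.one_apply]
  rw [this, map_one]

/-- The pulled-back inverse step-length tensor in terms of the Cauchy-Green tensor `FᵀF`. -/
theorem transpose_mul_ell_inv_mul (F : Matrix (Fin 3) (Fin 3) ℝ) (v : Fin 3 → ℝ) (s : ℝ) :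
    Fᵀ * ell s (nvec (F *ᵥ v)) * F = s ^ (-(1/3) : ℝ) • (Fᵀ * F +
      ((s - 1) * (v ⬝ᵥ (Fᵀ * F) *ᵥ v)⁻¹) • outer3 ((Fᵀ * F) *ᵥ v) ((Fᵀ * F) *ᵥ v)) := by
  have hd : v ⬝ᵥ (Fᵀ * F) *ᵥ v = F *ᵥ v ⬝ᵥ F *ᵥ v := by
    rw [← mulVec_mulVec, dotProduct_mulVec, vecMul_transpose]
  rw [hd, ← mulVec_mulVec, ← transpose_mul_outer3_mul, ell, outer3_nvec]
  simp only [Matrix.smul_mul, Matrix.mul_smul, Matrix.add_mul, Matrix.mul_add, Matrix.mul_one,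
    smul_smul]

theorem pullback_eq_iff {rf r0 : ℝ} (hrf : 0 < rf) (hr0 : 0 < r0) {v : Fin 3 → ℝ} (hv : unit3 v)
    (F : Matrix (Fin 3) (Fin 3) ℝ) (hF : F *ᵥ v ≠ 0) :
    Fᵀ * ell rf⁻¹ (nvec (F *ᵥ v)) * F = ell r0⁻¹ v ↔ Fᵀ * F = ell (rf / r0) v := by
  have ha : v ⬝ᵥ (Fᵀ * F) *ᵥ v ≠ 0 := by
    rw [← mulVec_mulVec, dotProduct_mulVec, vecMul_transpose]
    exact fun h => hF (dotProduct_self_eq_zero.1 h)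
  rw [transpose_mul_ell_inv_mul]
  generalize Fᵀ * F = C at *
  have hx : 0 < rf ^ (-(1/3) : ℝ) := by positivity
  have hy : 0 < r0 ^ (-(1/3) : ℝ) := by positivity
  rw [ell, ell, Real.inv_rpow hrf.le, Real.inv_rpow hr0.le, Real.div_rpow hrf.le hr0.le]
  generalize rf ^ (-(1/3) : ℝ) = x at *
  generalize r0 ^ (-(1/3) : ℝ) = y at *
  constructor
  · intro h
    have hC : C + ((rf⁻¹ - 1) * (v ⬝ᵥ C *ᵥ v)⁻¹) • outer3 (C *ᵥ v) (C *ᵥ v) =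
        (x / y) • (1 + (r0⁻¹ - 1) • outer3 v v) := by
      have h' := congrArg (fun M => x • M) h
      simp only [smul_smul, mul_inv_cancel₀ hx.ne', one_smul] at h'
      rw [h', div_eq_mul_inv]
    have hCv : C *ᵥ v = (x / y * (rf / r0)) • v := by
      have h' := congrArg (fun M => rf • (M *ᵥ v)) hC
      simp only [hv.uniaxial_mulVec, add_mulVec, smul_mulVec, outer3_mulVec] at h'
      rw [dotProduct_comm (C *ᵥ v) v, smul_smul, mul_assoc, inv_mul_cancel₀ ha, mul_one] at h'
      have h2 : rf • (C *ᵥ v + (rf⁻¹ - 1) • C *ᵥ v) = C *ᵥ v := by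
        match_scalars
        field_simp
        ring
      rw [← h2, h', smul_smul]
      congr 1
      field_simp
    rw [hCv, dotProduct_smul, hv.dotProduct_self, smul_eq_mul, mul_one, outer3_smul,
      smul_smul] at hC
    rw [eq_sub_of_add_eq hC]
    match_scalars <;> field_simp <;> ring
  · intro h
    rw [h, hv.uniaxial_mulVec, dotProduct_smul, hv.dotProduct_self, smul_eq_mul, mul_one,
      outer3_smul]
    match_scalars <;> field_simp <;> ring

theorem We_eq_zero_iff {rf r0 μ : ℝ} (hrf : 0 < rf) (hr0 : 0 < r0) (hμ : 0 < μ)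
    {v w : Fin 3 → ℝ} (hv : unit3 v) (hw : unit3 w)
    {F : Matrix (Fin 3) (Fin 3) ℝ} (hF : F.det = 1) :
    We μ rf r0 F w v = 0 ↔ Fᵀ * ell rf⁻¹ w * F = ell r0⁻¹ v := by
  rw [We, inv_eq_right_inv (hw.ell_mul_ell_inv hrf), mul_eq_zero_iff_left (by positivity),
    sub_eq_zero]
  have hS : ellInvSqrt r0⁻¹ v * ellInvSqrt r0⁻¹ v = ell r0 v := by
    simpa using hv.ellInvSqrt_mul_self (inv_pos.2 hr0)
  have hTS := hv.ellInvSqrt_mul_ellInvSqrt_inv hr0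
  have hST := mul_eq_one_comm.1 hTS
  constructor
  · intro h
    have hG : (ellInvSqrt rf w * F * ellInvSqrt r0⁻¹ v)ᵀ *
        (ellInvSqrt rf w * F * ellInvSqrt r0⁻¹ v) =
        ellInvSqrt r0⁻¹ v * (Fᵀ * ell rf⁻¹ w * F * ellInvSqrt r0⁻¹ v) := by
      rw [← hw.ellInvSqrt_mul_self hrf]
      simp only [transpose_mul, ellInvSqrt_transpose, Matrix.mul_assoc]
    have h1 := transpose_mul_self_eq_one
      (G := ellInvSqrt rf w * F * ellInvSqrt r0⁻¹ v)
      (by rw [det_mul, det_mul, hF, hw.det_ellInvSqrt hrf, hv.det_ellInvSqrt (inv_pos.2 hr0)]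
          norm_num)
      (by rw [hG, trace_mul_comm, Matrix.mul_assoc, hS, h])
    rw [hG] at h1
    calc Fᵀ * ell rf⁻¹ w * F
        = (ellInvSqrt r0 v * ellInvSqrt r0⁻¹ v) * (Fᵀ * ell rf⁻¹ w * F) *
          (ellInvSqrt r0⁻¹ v * ellInvSqrt r0 v) := by rw [hTS, hST, Matrix.one_mul, Matrix.mul_one]
      _ = ellInvSqrt r0 v * (ellInvSqrt r0⁻¹ v * (Fᵀ * ell rf⁻¹ w * F * ellInvSqrt r0⁻¹ v)) *
          ellInvSqrt r0 v := by simp only [Matrix.mul_assoc]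
      _ = ell r0⁻¹ v := by rw [h1, Matrix.mul_one, hv.ellInvSqrt_mul_self hr0]
  · intro h
    rw [h, mul_eq_one_comm.1 (hv.ell_mul_ell_inv hr0)]
    simp

theorem SO3_mul_ellInvSqrt {r : ℝ} (hr : 0 < r) {v : Fin 3 → ℝ} (hv : unit3 v)
    {F : Matrix (Fin 3) (Fin 3) ℝ} (hF : F.det = 1) (hC : Fᵀ * F = ell r v) :
    SO3 (F * ellInvSqrt r v) := by
  constructor
  · have hS : ellInvSqrt r⁻¹ v * ellInvSqrt r⁻¹ v = ell r v := by
      simpa using hv.ellInvSqrt_mul_self (inv_pos.2 hr)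
    have hTS := hv.ellInvSqrt_mul_ellInvSqrt_inv hr
    calc (F * ellInvSqrt r v)ᵀ * (F * ellInvSqrt r v)
        = ellInvSqrt r v * (Fᵀ * F) * ellInvSqrt r v := by
          simp only [transpose_mul, ellInvSqrt_transpose, Matrix.mul_assoc]
      _ = (ellInvSqrt r v * ellInvSqrt r⁻¹ v) * (ellInvSqrt r⁻¹ v * ellInvSqrt r v) := by
          rw [hC, ← hS]; simp only [Matrix.mul_assoc]
      _ = 1 := by rw [hTS, mul_eq_one_comm.1 hTS, Matrix.one_mul]
  · rw [det_mul, hF, hv.det_ellInvSqrt hr, one_mul]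

theorem nvec_mulVec_eq {r : ℝ} (hr : 0 < r) {v : Fin 3 → ℝ} (hv : unit3 v)
    {F : Matrix (Fin 3) (Fin 3) ℝ} (hC : Fᵀ * F = ell r v) :
    nvec (F *ᵥ v) = (F * ellInvSqrt r v) *ᵥ v := by
  have hd : F *ᵥ v ⬝ᵥ F *ᵥ v = (r ^ (1/3 : ℝ)) ^ 2 := by
    rw [← vecMul_transpose F, ← dotProduct_mulVec, vecMul_transpose, mulVec_mulVec, hC, ell, hv.uniaxial_mulVec,
      dotProduct_smul, hv.dotProduct_self, ← Real.rpow_natCast, ← Real.rpow_mul hr.le,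
      ← Real.rpow_add_one hr.ne']
    norm_num
  rw [nvec_eq_smul, hd, Real.sqrt_sq (by positivity), ← mulVec_mulVec, ellInvSqrt,
    hv.uniaxial_mulVec, mulVec_smul, ← Real.rpow_neg hr.le, ← Real.rpow_add hr]
  norm_num

/-- with `r = r_f/r_0`, for `F` with `Fν₀ ≠ 0`,
`det F = 1 ∧ W^e(F, Fν₀/|Fν₀|, ν₀) = 0` iff `det F = 1 ∧ FᵀF = ℓ_{ν₀}`; moreover in that
case `R = F·ℓ_{ν₀}^{-1/2} ∈ SO(3)` and `Fν₀/|Fν₀| = Rν₀`. -/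
theorem statement3 (rf r0 μ : ℝ) (hrf : 1 ≤ rf) (hr0 : 1 ≤ r0) (hμ : 0 < μ)
    (ν₀ : Fin 3 → ℝ) (hν₀ : unit3 ν₀)
    (F : Matrix (Fin 3) (Fin 3) ℝ) (hFν : F.mulVec ν₀ ≠ 0) :
    ((F.det = 1 ∧ We μ rf r0 F (nvec (F.mulVec ν₀)) ν₀ = 0) ↔
      (F.det = 1 ∧ Fᵀ * F = ell (rf / r0) ν₀)) ∧
    ((F.det = 1 ∧ Fᵀ * F = ell (rf / r0) ν₀) →
      SO3 (F * ellInvSqrt (rf / r0) ν₀) ∧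
      nvec (F.mulVec ν₀) = (F * ellInvSqrt (rf / r0) ν₀).mulVec ν₀) := by
  have hf : 0 < rf := by linarith
  have h0 : 0 < r0 := by linarith
  refine ⟨and_congr_right fun hdet => ?_, fun h => ?_⟩
  · rw [We_eq_zero_iff hf h0 hμ hν₀ (unit3_nvec hFν) hdet]
    exact pullback_eq_iff hf h0 hν₀ F hFν
  · exact ⟨SO3_mul_ellInvSqrt (div_pos hf h0) hν₀ h.1 h.2,
      nvec_mulVec_eq (div_pos hf h0) hν₀ h.2⟩
end
end

section
/- Let r > 0, let ν₀ ∈ ℝ³ be a unit vector, and let F̃ ∈ ℝ^{3×2} satisfy F̃ᵀF̃ = ℓ̃_{ν₀}. Then there exists a vector b ∈ ℝ³ such that the 3×3 matrix (F̃ | b), whose first two columns are the columns of F̃ and whose third column is b, satisfies (F̃|b)ᵀ(F̃|b) = ℓ_{ν₀} and det(F̃|b) = 1. -/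
open Matrix

noncomputable section

/-- Two-dimensional tensor `ℓ̃_ν = r^{-1/3}(I₂ + (r-1) ν̃ ⊗ ν̃)`, where `ν̃` is the
planar projection of `ν`. -/
def ellT (r : ℝ) (v : Fin 3 → ℝ) : Matrix (Fin 2) (Fin 2) ℝ :=
  r ^ (-(1/3) : ℝ) • (1 + (r - 1) • Matrix.of (fun i j : Fin 2 => v i.castSucc * v j.castSucc))

/-- The 3×3 matrix `(F̃ | b)` whose first two columns are those of `F̃ ∈ ℝ^{3×2}` and
whose third column is `b ∈ ℝ³`. -/
def aug (F : Matrix (Fin 3) (Fin 2) ℝ) (b : Fin 3 → ℝ) : Matrix (Fin 3) (Fin 3) ℝ :=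
  Matrix.of fun i j => if h : (j : ℕ) < 2 then F i ⟨j, h⟩ else b i

/-- The entrywise form of `Fᵀ * F = ellT r v`. -/
lemma dot_columns_of_transpose_mul_eq_ellT {r : ℝ} {v : Fin 3 → ℝ}
    {F : Matrix (Fin 3) (Fin 2) ℝ} (hF : Fᵀ * F = ellT r v) (i j : Fin 2) :
    F 0 i * F 0 j + F 1 i * F 1 j + F 2 i * F 2 j =
      r ^ (-(1/3) : ℝ) * ((1 : Matrix (Fin 2) (Fin 2) ℝ) i j +
        (r - 1) * (v i.castSucc * v j.castSucc)) := by
  simpa [Matrix.mul_apply, Fin.sum_univ_three, ellT] using congrFun (congrFun hF i) j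

/-- if `F̃ᵀF̃ = ℓ̃_{ν₀}` then there is `b ∈ ℝ³` with
`(F̃|b)ᵀ(F̃|b) = ℓ_{ν₀}` and `det(F̃|b) = 1`. -/
theorem statement5 (r : ℝ) (hr : 0 < r) (ν₀ : Fin 3 → ℝ) (hν₀ : unit3 ν₀)
    (F : Matrix (Fin 3) (Fin 2) ℝ) (hF : Fᵀ * F = ellT r ν₀) :
    ∃ b : Fin 3 → ℝ, (aug F b)ᵀ * aug F b = ell r ν₀ ∧ (aug F b).det = 1 := by
  have g11 := dot_columns_of_transpose_mul_eq_ellT hF 0 0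
  have g12 := dot_columns_of_transpose_mul_eq_ellT hF 0 1
  have g22 := dot_columns_of_transpose_mul_eq_ellT hF 1 1
  have hk : (r ^ (-(1/3) : ℝ)) ^ 3 * r = 1 := by
    rw [← Real.rpow_natCast, ← Real.rpow_mul hr.le, ← Real.rpow_add_one hr.ne']
    norm_num
  unfold ell
  generalize r ^ (-(1/3) : ℝ) = k at g11 g12 g22 hk ⊢
  simp only [unit3, Fin.sum_univ_three] at hν₀
  simp only [Fin.castSucc_zero, Fin.castSucc_one, Matrix.one_apply_eq,
    Matrix.one_apply_ne (zero_ne_one : (0 : Fin 2) ≠ 1)] at g11 g12 g22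
  generalize hx : ν₀ 0 = x at *
  generalize hy : ν₀ 1 = y at *
  generalize hz : ν₀ 2 = z at *
  generalize hp0 : F 0 0 = p0 at *
  generalize hp1 : F 1 0 = p1 at *
  generalize hp2 : F 2 0 = p2 at *
  generalize hq0 : F 0 1 = q0 at *
  generalize hq1 : F 1 1 = q1 at *
  generalize hq2 : F 2 1 = q2 at *
  have hd : 0 < 1 + (r - 1) * (x ^ 2 + y ^ 2) := by
    nlinarith [mul_nonneg hr.le (add_nonneg (sq_nonneg x) (sq_nonneg y)), sq_nonneg z,
      mul_nonneg hr.le (sq_nonneg z)]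
  obtain ⟨e, he⟩ : ∃ e, e * (1 + (r - 1) * (x ^ 2 + y ^ 2)) = 1 :=
    ⟨_, inv_mul_cancel₀ hd.ne'⟩
  -- The cross product of the columns has squared length `det (ellT r ν₀)`.
  have hw : (p1 * q2 - p2 * q1) ^ 2 + (p2 * q0 - p0 * q2) ^ 2 + (p0 * q1 - p1 * q0) ^ 2 =
      k ^ 2 * (1 + (r - 1) * (x ^ 2 + y ^ 2)) := by
    linear_combination (q0 * q0 + q1 * q1 + q2 * q2) * g11 +
      (k * (1 + (r - 1) * (x * x))) * g22 -
      (p0 * q0 + p1 * q1 + p2 * q2 + k * (0 + (r - 1) * (x * y))) * g12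
  have hb1 : p0 * (e * ((r - 1) * z * (x * p0 + y * q0) + k * r * (p1 * q2 - p2 * q1))) +
      p1 * (e * ((r - 1) * z * (x * p1 + y * q1) + k * r * (p2 * q0 - p0 * q2))) +
      p2 * (e * ((r - 1) * z * (x * p2 + y * q2) + k * r * (p0 * q1 - p1 * q0))) =
      k * ((r - 1) * (x * z)) := by
    linear_combination e * (r - 1) * z * x * g11 + e * (r - 1) * z * y * g12 +
      k * (r - 1) * x * z * he
  have hb2 : q0 * (e * ((r - 1) * z * (x * p0 + y * q0) + k * r * (p1 * q2 - p2 * q1))) +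
      q1 * (e * ((r - 1) * z * (x * p1 + y * q1) + k * r * (p2 * q0 - p0 * q2))) +
      q2 * (e * ((r - 1) * z * (x * p2 + y * q2) + k * r * (p0 * q1 - p1 * q0))) =
      k * ((r - 1) * (y * z)) := by
    linear_combination e * (r - 1) * z * x * g12 + e * (r - 1) * z * y * g22 +
      k * (r - 1) * y * z * he
  have hdet : (p1 * q2 - p2 * q1) *
        (e * ((r - 1) * z * (x * p0 + y * q0) + k * r * (p1 * q2 - p2 * q1))) +
      (p2 * q0 - p0 * q2) *
        (e * ((r - 1) * z * (x * p1 + y * q1) + k * r * (p2 * q0 - p0 * q2))) +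
      (p0 * q1 - p1 * q0) *
        (e * ((r - 1) * z * (x * p2 + y * q2) + k * r * (p0 * q1 - p1 * q0))) = 1 := by
    linear_combination e * k * r * hw + k ^ 3 * r * he + hk
  have hbb : (e * ((r - 1) * z * (x * p0 + y * q0) + k * r * (p1 * q2 - p2 * q1))) ^ 2 +
      (e * ((r - 1) * z * (x * p1 + y * q1) + k * r * (p2 * q0 - p0 * q2))) ^ 2 +
      (e * ((r - 1) * z * (x * p2 + y * q2) + k * r * (p0 * q1 - p1 * q0))) ^ 2 =
      k * (1 + (r - 1) * (z * z)) := by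
    linear_combination e * (r - 1) * z * x * hb1 + e * (r - 1) * z * y * hb2 +
      e * k * r * hdet + k * (1 + (r - 1) * z ^ 2) * he - e * k * (r - 1) * hν₀
  refine ⟨![e * ((r - 1) * z * (x * p0 + y * q0) + k * r * (p1 * q2 - p2 * q1)),
    e * ((r - 1) * z * (x * p1 + y * q1) + k * r * (p2 * q0 - p0 * q2)),
    e * ((r - 1) * z * (x * p2 + y * q2) + k * r * (p0 * q1 - p1 * q0))], ?_, ?_⟩
  · generalize e * ((r - 1) * z * (x * p0 + y * q0) + k * r * (p1 * q2 - p2 * q1)) = b0 at *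
    generalize e * ((r - 1) * z * (x * p1 + y * q1) + k * r * (p2 * q0 - p0 * q2)) = b1 at *
    generalize e * ((r - 1) * z * (x * p2 + y * q2) + k * r * (p0 * q1 - p1 * q0)) = b2 at *
    ext i j
    fin_cases i <;> fin_cases j <;>
      simp [Matrix.mul_apply, Fin.sum_univ_three, aug, outer3, hx, hy, hz, hp0, hp1, hp2,
        hq0, hq1, hq2] <;>
      linarith
  · rw [Matrix.det_fin_three]
    simp only [aug, Matrix.of_apply]
    simp [hp0, hp1, hp2, hq0, hq1, hq2]
    linear_combination hdet
end
end

section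
/- Let r > 1, let F̃ ∈ ℝ^{3×2}, and let ν₀ ∈ ℝ³ be a unit vector. Then F̃ᵀF̃ = ℓ̃_{ν₀} if and only if F̃ ∈ D_r and ν₀ ∈ N^r_{F̃}. -/
open Matrix

noncomputable section

/-- Squared length of the `j`-th column `F ẽ_j` of `F ∈ ℝ^{3×2}`. -/
def colsq (F : Matrix (Fin 3) (Fin 2) ℝ) (j : Fin 2) : ℝ := ∑ i, (F i j) ^ 2

/-- Dot product `F ẽ₁ · F ẽ₂` of the columns of `F ∈ ℝ^{3×2}`. -/
def coldot (F : Matrix (Fin 3) (Fin 2) ℝ) : ℝ := ∑ i, F i 0 * F i 1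

/-- A real number is determined by its square and its sign. -/
theorem Real.eq_of_sq_eq_sq_of_sign_eq {x y : ℝ} (hsq : x ^ 2 = y ^ 2)
    (hsign : Real.sign x = Real.sign y) : x = y := by
  rcases sq_eq_sq_iff_eq_or_eq_neg.mp hsq with h | h
  · exact h
  · rw [h, Real.sign_neg] at hsign
    have hy : y = 0 := Real.sign_eq_zero_iff.mp (by linarith)
    simp [h, hy]

theorem Real.sign_mul_of_pos_left {d : ℝ} (hd : 0 < d) (x : ℝ) :
    Real.sign (d * x) = Real.sign x := by
  rcases lt_trichotomy x 0 with hx | rfl | hx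
  · rw [Real.sign_of_neg hx, Real.sign_of_neg (mul_neg_of_pos_of_neg hd hx)]
  · simp
  · rw [Real.sign_of_pos hx, Real.sign_of_pos (mul_pos hd hx)]

theorem frob2_eq_colsq_add_colsq (F : Matrix (Fin 3) (Fin 2) ℝ) :
    frob2 F = colsq F 0 + colsq F 1 := by
  simp [frob2, colsq, Finset.sum_add_distrib]

/-- The Gram matrix of `F` equals `ellT r v` iff its three distinct entries agree. -/
theorem transpose_mul_self_eq_ellT_iff (r : ℝ) (F : Matrix (Fin 3) (Fin 2) ℝ)
    (v : Fin 3 → ℝ) :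
    Fᵀ * F = ellT r v ↔
      (∀ j : Fin 2, colsq F j = r ^ (-(1/3) : ℝ) + r ^ (-(1/3) : ℝ) * (r - 1) * v j.castSucc ^ 2) ∧
        coldot F = r ^ (-(1/3) : ℝ) * (r - 1) * (v 0 * v 1) := by
  generalize ha : r ^ (-(1/3) : ℝ) = a
  simp only [← Matrix.ext_iff, Fin.forall_fin_two, ellT, ha, colsq, coldot, Matrix.mul_apply,
    Matrix.transpose_apply, Matrix.smul_apply, Matrix.add_apply, Matrix.of_apply, smul_eq_mul,
    Matrix.one_apply, Fin.sum_univ_three, Fin.castSucc_zero, Fin.castSucc_one]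
  norm_num
  constructor
  · rintro ⟨⟨h00, h01⟩, -, h11⟩
    exact ⟨⟨by linarith, by linarith⟩, by linarith⟩
  · rintro ⟨⟨h0, h1⟩, h01⟩
    exact ⟨⟨by linarith, by linarith⟩, by linarith, by linarith⟩

/-- `r > 1`: `F̃ᵀF̃ = ℓ̃_{ν₀}` iff `F̃ ∈ D_r` and `ν₀ ∈ N^r_{F̃}`. -/
theorem statement6 (r : ℝ) (hr : 1 < r)
    (F : Matrix (Fin 3) (Fin 2) ℝ) (ν₀ : Fin 3 → ℝ) (hν₀ : unit3 ν₀) :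
    Fᵀ * F = ellT r ν₀ ↔
      ((frob2 F ≤ r ^ (-(1/3) : ℝ) + r ^ ((2/3) : ℝ) ∧
        (∀ j : Fin 2, r ^ (-(1/3) : ℝ) ≤ colsq F j ∧ colsq F j ≤ r ^ ((2/3) : ℝ)) ∧
        (coldot F) ^ 2 = (colsq F 0 - r ^ (-(1/3) : ℝ)) * (colsq F 1 - r ^ (-(1/3) : ℝ))) ∧
       ((∀ j : Fin 2, (ν₀ j.castSucc) ^ 2 =
          (colsq F j - r ^ (-(1/3) : ℝ)) / (r ^ ((2/3) : ℝ) - r ^ (-(1/3) : ℝ))) ∧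
        Real.sign (ν₀ 0 * ν₀ 1) = Real.sign (coldot F))) := by
  have hr0 : 0 < r := by linarith
  have hpow : r ^ ((2/3) : ℝ) = r ^ (-(1/3) : ℝ) + r ^ (-(1/3) : ℝ) * (r - 1) := by
    rw [show ((2/3) : ℝ) = -(1/3) + 1 by norm_num, Real.rpow_add_one hr0.ne']
    ring
  have hd : 0 < r ^ (-(1/3) : ℝ) * (r - 1) :=
    mul_pos (Real.rpow_pos_of_pos hr0 _) (by linarith)
  rw [transpose_mul_self_eq_ellT_iff, frob2_eq_colsq_add_colsq, hpow]
  generalize r ^ (-(1/3) : ℝ) * (r - 1) = d at hd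
  generalize r ^ (-(1/3) : ℝ) = a
  simp only [unit3, Fin.sum_univ_three] at hν₀
  simp only [Fin.forall_fin_two, Fin.castSucc_zero, Fin.castSucc_one, add_sub_cancel_left,
    eq_div_iff hd.ne']
  have h0 := mul_nonneg hd.le (sq_nonneg (ν₀ 0))
  have h1 := mul_nonneg hd.le (sq_nonneg (ν₀ 1))
  have h2 := mul_nonneg hd.le (sq_nonneg (ν₀ 2))
  have hsum : d * ν₀ 0 ^ 2 + d * ν₀ 1 ^ 2 + d * ν₀ 2 ^ 2 = d := by
    rw [← mul_add, ← mul_add, hν₀, mul_one]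
  constructor
  · rintro ⟨⟨hc0, hc1⟩, hdot⟩
    rw [hc0, hc1, hdot, Real.sign_mul_of_pos_left hd]
    refine ⟨⟨by linarith, ⟨⟨?_, ?_⟩, ?_, ?_⟩, by ring⟩, ⟨by ring, by ring⟩, rfl⟩ <;> linarith
  · rintro ⟨⟨-, -, hdot⟩, ⟨hc0, hc1⟩, hsign⟩
    refine ⟨⟨by linarith, by linarith⟩, Real.eq_of_sq_eq_sq_of_sign_eq ?_ ?_⟩
    · rw [hdot, ← hc0, ← hc1]
      ring
    · rw [Real.sign_mul_of_pos_left hd, hsign]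
end
end

section
/- Let r > 1 and let F̃ ∈ D_r. Then the set N^r_{F̃} is nonempty; that is, there exists a unit vector ν₀ ∈ ℝ³ with (ν₀·e_α)² = (|F̃ ẽ_α|² − r^{−1/3})/(r^{2/3} − r^{−1/3}) for α = 1, 2 and sign((ν₀·e₁)(ν₀·e₂)) = sign(F̃ ẽ₁ · F̃ ẽ₂). -/
open Matrix

noncomputable section

theorem Real.exists_sq_eq_sq_eq_mul_eq {a b s : ℝ} (ha : 0 ≤ a) (hb : 0 ≤ b)
    (hs : s ^ 2 = a * b) : ∃ x y : ℝ, x ^ 2 = a ∧ y ^ 2 = b ∧ x * y = s := by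
  have key : √a * √b = |s| := by rw [← Real.sqrt_mul ha, ← hs, Real.sqrt_sq_eq_abs]
  rcases abs_choice s with h | h
  · exact ⟨√a, √b, Real.sq_sqrt ha, Real.sq_sqrt hb, by rw [key, h]⟩
  · exact ⟨√a, -√b, Real.sq_sqrt ha, by rw [neg_sq, Real.sq_sqrt hb],
      by rw [mul_neg, key, h, neg_neg]⟩

theorem Real.sign_div_of_pos (s : ℝ) {d : ℝ} (hd : 0 < d) :
    Real.sign (s / d) = Real.sign s := by
  rcases lt_trichotomy s 0 with h | rfl | h
  · rw [Real.sign_of_neg h, Real.sign_of_neg (div_neg_of_neg_of_pos h hd)]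
  · rw [zero_div]
  · rw [Real.sign_of_pos h, Real.sign_of_pos (div_pos h hd)]

/-- `r > 1`: if `F̃ ∈ D_r` then `N^r_{F̃}` is nonempty, i.e. there is a
unit vector `ν₀ ∈ ℝ³` with `(ν₀·e_α)² = (|F̃ẽ_α|² - r^{-1/3})/(r^{2/3} - r^{-1/3})` for
`α = 1,2` and `sign((ν₀·e₁)(ν₀·e₂)) = sign(F̃ẽ₁ · F̃ẽ₂)`. -/
theorem statement8 (r : ℝ) (hr : 1 < r) (F : Matrix (Fin 3) (Fin 2) ℝ)
    (hD : frob2 F ≤ r ^ (-(1/3) : ℝ) + r ^ ((2/3) : ℝ) ∧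
      (∀ j : Fin 2, r ^ (-(1/3) : ℝ) ≤ colsq F j ∧ colsq F j ≤ r ^ ((2/3) : ℝ)) ∧
      (coldot F) ^ 2 = (colsq F 0 - r ^ (-(1/3) : ℝ)) * (colsq F 1 - r ^ (-(1/3) : ℝ))) :
    ∃ ν₀ : Fin 3 → ℝ, (∑ i, (ν₀ i) ^ 2 = 1) ∧
      (∀ j : Fin 2, (ν₀ j.castSucc) ^ 2 =
        (colsq F j - r ^ (-(1/3) : ℝ)) / (r ^ ((2/3) : ℝ) - r ^ (-(1/3) : ℝ))) ∧
      Real.sign (ν₀ 0 * ν₀ 1) = Real.sign (coldot F) := by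
  obtain ⟨hF, hcol, hdot⟩ := hD
  rw [frob2_eq_colsq_add_colsq] at hF
  set p := r ^ (-(1/3) : ℝ)
  set q := r ^ ((2/3) : ℝ)
  have hd : 0 < q - p := sub_pos.2 (Real.rpow_lt_rpow_of_exponent_lt hr (by norm_num))
  obtain ⟨x, y, hx, hy, hxy⟩ := Real.exists_sq_eq_sq_eq_mul_eq
    (a := (colsq F 0 - p) / (q - p)) (b := (colsq F 1 - p) / (q - p)) (s := coldot F / (q - p))
    (div_nonneg (sub_nonneg.2 (hcol 0).1) hd.le) (div_nonneg (sub_nonneg.2 (hcol 1).1) hd.le)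
    (by rw [div_pow, hdot, div_mul_div_comm, sq])
  have hz : 0 ≤ 1 - x ^ 2 - y ^ 2 := by
    have : (colsq F 0 - p) / (q - p) + (colsq F 1 - p) / (q - p) ≤ 1 := by
      rw [← add_div, div_le_one hd]
      linarith
    linarith
  refine ⟨![x, y, √(1 - x ^ 2 - y ^ 2)], ?_, ?_, ?_⟩
  · simp [Fin.sum_univ_three, Real.sq_sqrt hz]
  · rw [Fin.forall_fin_two]
    exact ⟨hx, hy⟩
  · change Real.sign (x * y) = _
    rw [hxy, Real.sign_div_of_pos _ hd]
end
end

section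
/- Let r > 0, let ν₀ ∈ ℝ³ be a unit vector, and let F̃ ∈ ℝ^{3×2}. Then F̃ᵀF̃ = ℓ̃_{ν₀} if and only if there exists R ∈ SO(3) such that F̃ = R·(ℓ_{ν₀}^{1/2})_{3×2}. -/
open Matrix

noncomputable section

/-- `(ℓ_ν^{1/2})_{3×2} = r^{-1/6}(I_{3×2} + (r^{1/2}-1) ν ⊗ ν̃)`. -/
def ellSqrt32 (r : ℝ) (v : Fin 3 → ℝ) : Matrix (Fin 3) (Fin 2) ℝ :=
  r ^ (-(1/6) : ℝ) • Matrix.of (fun (i : Fin 3) (j : Fin 2) =>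
    (if (i : ℕ) = (j : ℕ) then 1 else 0) + (r ^ ((1/2) : ℝ) - 1) * (v i * v j.castSucc))

/-- The square matrix `[a | b | a × b]` obtained from a `3 × 2` matrix with columns `a`, `b`. -/
def crossExtend (A : Matrix (Fin 3) (Fin 2) ℝ) : Matrix (Fin 3) (Fin 3) ℝ :=
  Matrix.of fun i => ![A i 0, A i 1, crossProduct (A.col 0) (A.col 1) i]

theorem crossExtend_castSucc (A : Matrix (Fin 3) (Fin 2) ℝ) (i : Fin 3) (j : Fin 2) :
    crossExtend A i j.castSucc = A i j := by
  fin_cases j <;> rfl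

theorem det_crossExtend (A : Matrix (Fin 3) (Fin 2) ℝ) :
    (crossExtend A).det = (Aᵀ * A).det := by
  simp [crossExtend, det_fin_three, det_fin_two, mul_apply, Fin.sum_univ_three, cross_apply]
  ring

theorem crossExtend_transpose_mul_self (A : Matrix (Fin 3) (Fin 2) ℝ) :
    (crossExtend A)ᵀ * crossExtend A =
      !![(Aᵀ * A) 0 0, (Aᵀ * A) 0 1, 0; (Aᵀ * A) 1 0, (Aᵀ * A) 1 1, 0; 0, 0, (Aᵀ * A).det] := by
  ext i j
  fin_cases i <;> fin_cases j <;>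
    simp [crossExtend, det_fin_two, mul_apply, Fin.sum_univ_three, cross_apply] <;> ring

theorem SO3.transpose_mul_self_mul {R : Matrix (Fin 3) (Fin 3) ℝ} (hR : SO3 R)
    (A : Matrix (Fin 3) (Fin 2) ℝ) : (R * A)ᵀ * (R * A) = Aᵀ * A := by
  rw [transpose_mul, Matrix.mul_assoc, ← Matrix.mul_assoc Rᵀ, hR.1, Matrix.one_mul]

/-- Two `3 × 2` matrices of full rank with the same Gram matrix differ by a rotation. -/
theorem exists_SO3_mul_eq {A F : Matrix (Fin 3) (Fin 2) ℝ} (h : Fᵀ * F = Aᵀ * A)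
    (hA : (Aᵀ * A).det ≠ 0) : ∃ R : Matrix (Fin 3) (Fin 3) ℝ, SO3 R ∧ F = R * A := by
  have hdet : IsUnit (crossExtend A).det := by
    rw [det_crossExtend]
    exact hA.isUnit
  have hgram : (crossExtend F)ᵀ * crossExtend F = (crossExtend A)ᵀ * crossExtend A := by
    rw [crossExtend_transpose_mul_self, crossExtend_transpose_mul_self, h]
  refine ⟨crossExtend F * (crossExtend A)⁻¹, ⟨?_, ?_⟩, ?_⟩
  · rw [transpose_mul, Matrix.mul_assoc, ← Matrix.mul_assoc (crossExtend F)ᵀ, hgram,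
      Matrix.mul_assoc, mul_nonsing_inv _ hdet, Matrix.mul_one, ← transpose_mul,
      mul_nonsing_inv _ hdet, transpose_one]
  · rw [det_mul, det_crossExtend F, h, ← det_crossExtend A, ← det_mul, mul_nonsing_inv _ hdet,
      det_one]
  · have key := nonsing_inv_mul_cancel_right (crossExtend A) (crossExtend F) hdet
    ext i j
    have hij := congrFun (congrFun key i) j.castSucc
    rw [crossExtend_castSucc, mul_apply] at hij
    simp only [crossExtend_castSucc] at hij
    rw [← hij, mul_apply]

theorem ellSqrt32_transpose_mul_self {r : ℝ} (hr : 0 < r) {v : Fin 3 → ℝ} (hv : unit3 v) :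
    (ellSqrt32 r v)ᵀ * ellSqrt32 r v = ellT r v := by
  have hs : r = r ^ ((1/2) : ℝ) * r ^ ((1/2) : ℝ) := by
    rw [← Real.rpow_add hr]
    norm_num
  have ht : r ^ (-(1/3) : ℝ) = r ^ (-(1/6) : ℝ) * r ^ (-(1/6) : ℝ) := by
    rw [← Real.rpow_add hr]
    norm_num
  have hv2 : v 2 ^ 2 = 1 - v 0 ^ 2 - v 1 ^ 2 := by
    rw [unit3, Fin.sum_univ_three] at hv
    linarith
  unfold ellT ellSqrt32
  rw [ht]
  generalize r ^ (-(1/6) : ℝ) = t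
  generalize r ^ ((1/2) : ℝ) = s at *
  subst hs
  ext i j
  fin_cases i <;> fin_cases j <;> simp [mul_apply, Fin.sum_univ_three] <;> ring_nf <;>
    rw [hv2] <;> ring

theorem det_ellT_pos {r : ℝ} (hr : 0 < r) {v : Fin 3 → ℝ} (hv : unit3 v) :
    0 < (ellT r v).det := by
  have hv2 : v 2 ^ 2 = 1 - v 0 ^ 2 - v 1 ^ 2 := by
    rw [unit3, Fin.sum_univ_three] at hv
    linarith
  have hdet : (ellT r v).det =
      (r ^ (-(1/3) : ℝ)) ^ 2 * (v 2 ^ 2 + r * (v 0 ^ 2 + v 1 ^ 2)) := by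
    rw [hv2]
    simp [ellT, det_fin_two]
    ring
  rw [hdet]
  refine mul_pos (pow_pos (Real.rpow_pos_of_pos hr _) 2) ?_
  rcases (sq_nonneg (v 2)).eq_or_lt with h0 | hpos
  · have h1 : v 0 ^ 2 + v 1 ^ 2 = 1 := by linarith
    rw [h1, ← h0]
    linarith
  · positivity

/-- for `r > 0` and a unit vector `ν₀`, `F̃ᵀF̃ = ℓ̃_{ν₀}` iff
`F̃ = R (ℓ_{ν₀}^{1/2})_{3×2}` for some `R ∈ SO(3)`. -/
theorem statement9 (r : ℝ) (hr : 0 < r) (ν₀ : Fin 3 → ℝ) (hν₀ : unit3 ν₀)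
    (F : Matrix (Fin 3) (Fin 2) ℝ) :
    Fᵀ * F = ellT r ν₀ ↔ ∃ R : Matrix (Fin 3) (Fin 3) ℝ, SO3 R ∧ F = R * ellSqrt32 r ν₀ := by
  rw [← ellSqrt32_transpose_mul_self hr hν₀]
  constructor
  · intro h
    refine exists_SO3_mul_eq h ?_
    rw [ellSqrt32_transpose_mul_self hr hν₀]
    exact (det_ellT_pos hr hν₀).ne'
  · rintro ⟨R, hR, rfl⟩
    exact hR.transpose_mul_self_mul _
end
end

section
/- Let r > 0 with r ≠ 1, let ν_α, ν_β ∈ ℝ³ be unit vectors, let R_α, R_β ∈ SO(3), and let t̃ ∈ ℝ² be a unit vector. If R_α (ℓ_{ν_α}^{1/2})_{3×2} t̃ = R_β (ℓ_{ν_β}^{1/2})_{3×2} t̃, then |ν̃_α · t̃| = |ν̃_β · t̃|, where ν̃ := (ν·e₁, ν·e₂) ∈ ℝ² denotes the planar projection of ν. -/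
open Matrix

noncomputable section

/-- A matrix with orthonormal columns preserves the dot product of a vector with itself. -/
theorem dotProduct_self_mulVec_of_transpose_mul_self {R : Matrix (Fin 3) (Fin 3) ℝ}
    (hR : Rᵀ * R = 1) (w : Fin 3 → ℝ) : (R *ᵥ w) ⬝ᵥ (R *ᵥ w) = w ⬝ᵥ w := by
  rw [dotProduct_mulVec, vecMul_mulVec, hR, vecMul_one]

/-- The squared stretch of a planar unit vector depends on `ν` only through `(ν̃ · t̃)²`. -/
theorem dotProduct_self_ellSqrt32_mulVec {r : ℝ} (hr : 0 < r) {v : Fin 3 → ℝ} (hv : unit3 v)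
    {t : Fin 2 → ℝ} (ht : ∑ i, (t i) ^ 2 = 1) :
    (ellSqrt32 r v *ᵥ t) ⬝ᵥ (ellSqrt32 r v *ᵥ t) =
      (r ^ (-(1/6) : ℝ)) ^ 2 * (1 + (r - 1) * (v 0 * t 0 + v 1 * t 1) ^ 2) := by
  have hs : (r ^ ((1/2) : ℝ)) ^ 2 = r := by
    rw [← Real.sqrt_eq_rpow, Real.sq_sqrt hr.le]
  simp only [unit3, Fin.sum_univ_three] at hv
  simp only [Fin.sum_univ_two] at ht
  simp only [ellSqrt32, smul_mulVec, dotProduct_smul, smul_dotProduct, smul_eq_mul]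
  simp [dotProduct, mulVec, Fin.sum_univ_three, Fin.sum_univ_two]
  norm_num at hs ⊢
  generalize r ^ (1/2 : ℝ) = s at *
  generalize r ^ (-(1/6) : ℝ) = c at *
  subst hs
  linear_combination c ^ 2 * ht + c ^ 2 * (s - 1) ^ 2 * (v 0 * t 0 + v 1 * t 1) ^ 2 * hv

/-- if `R_α (ℓ_{ν_α}^{1/2})_{3×2} t̃ = R_β (ℓ_{ν_β}^{1/2})_{3×2} t̃` for a
unit vector `t̃ ∈ ℝ²`, then `|ν̃_α · t̃| = |ν̃_β · t̃|`. -/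
theorem statement10 (r : ℝ) (hr : 0 < r) (hr1 : r ≠ 1)
    (να νβ : Fin 3 → ℝ) (huα : unit3 να) (huβ : unit3 νβ)
    (Rα Rβ : Matrix (Fin 3) (Fin 3) ℝ) (hRα : SO3 Rα) (hRβ : SO3 Rβ)
    (t : Fin 2 → ℝ) (ht : ∑ i, (t i) ^ 2 = 1)
    (hcompat : (Rα * ellSqrt32 r να).mulVec t = (Rβ * ellSqrt32 r νβ).mulVec t) :
    |να 0 * t 0 + να 1 * t 1| = |νβ 0 * t 0 + νβ 1 * t 1| := by
  rw [← sq_eq_sq_iff_abs_eq_abs]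
  have h := congrArg (fun w => w ⬝ᵥ w) hcompat
  simp only [← mulVec_mulVec, dotProduct_self_mulVec_of_transpose_mul_self hRα.1,
    dotProduct_self_mulVec_of_transpose_mul_self hRβ.1,
    dotProduct_self_ellSqrt32_mulVec hr huα ht, dotProduct_self_ellSqrt32_mulVec hr huβ ht] at h
  have hc : (r ^ (-(1/6) : ℝ)) ^ 2 ≠ 0 := (pow_pos (Real.rpow_pos_of_pos hr _) 2).ne'
  exact mul_left_cancel₀ (sub_ne_zero.mpr hr1) (add_left_cancel (mul_left_cancel₀ hc h))
end
end

section
/- Let r > 1 and set λ := r − 1. Let g = (g₁, g₂) ∈ ℝ² with |g|² ≤ λ. Define F̃ ∈ ℝ^{3×2} by F̃ := r^{−1/6}(I_{3×2} + e₃ ⊗ g), i.e., the top 2×2 block of F̃ is r^{−1/6} I₂ and the third row of F̃ is r^{−1/6}(g₁, g₂), and define ν₀ := λ^{−1/2}(g₁, g₂, (λ − |g|²)^{1/2}) ∈ ℝ³. Then ν₀ is a unit vector and F̃ᵀF̃ = ℓ̃_{ν₀}. -/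
open Matrix

noncomputable section

/-- lifted surfaces, pointwise identity: for `r > 1`, `λ = r - 1`,
`g ∈ ℝ²` with `|g|² ≤ λ`, the matrix `F̃ = r^{-1/6}(I_{3×2} + e₃ ⊗ g)` and the vector
`ν₀ = λ^{-1/2}(g₁, g₂, (λ - |g|²)^{1/2})` satisfy: `ν₀` is a unit vector and
`F̃ᵀF̃ = ℓ̃_{ν₀}`. -/
theorem statement11 (r : ℝ) (hr : 1 < r) (g : Fin 2 → ℝ) (hg : ∑ j, (g j) ^ 2 ≤ r - 1)
    (F : Matrix (Fin 3) (Fin 2) ℝ)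
    (hF : F = Matrix.of fun (i : Fin 3) (j : Fin 2) =>
      r ^ (-(1/6) : ℝ) * ((if (i : ℕ) = (j : ℕ) then 1 else 0) +
        (if (i : ℕ) = 2 then g j else 0)))
    (ν₀ : Fin 3 → ℝ)
    (hν₀ : ν₀ = fun i : Fin 3 => (r - 1) ^ (-(1/2) : ℝ) *
      (if h : (i : ℕ) < 2 then g ⟨i, h⟩ else Real.sqrt ((r - 1) - ∑ j, (g j) ^ 2))) :
    unit3 ν₀ ∧ Fᵀ * F = ellT r ν₀ := by
  have hl : 0 < r - 1 := sub_pos.mpr hr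
  have hc : (r - 1) * ((r - 1) ^ (-(1/2) : ℝ)) ^ 2 = 1 := by
    rw [← Real.rpow_natCast, ← Real.rpow_mul hl.le]
    norm_num [Real.rpow_neg_one, hl.ne']
  have hb : (r ^ (-(1/6) : ℝ)) ^ 2 = r ^ (-(1/3) : ℝ) := by
    rw [← Real.rpow_natCast, ← Real.rpow_mul (by linarith)]
    norm_num
  have hs := Real.sq_sqrt (sub_nonneg.mpr hg)
  subst hF hν₀
  generalize (r - 1) ^ (-(1/2) : ℝ) = c at *
  generalize √((r - 1) - ∑ j, (g j) ^ 2) = s at *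
  rw [Fin.sum_univ_two] at hs
  constructor
  · simp [unit3, Fin.sum_univ_three]
    linear_combination hc + c ^ 2 * hs
  · rw [ellT, ← hb]
    generalize r ^ (-(1/6) : ℝ) = b at *
    ext i j
    fin_cases i <;> fin_cases j <;> simp [Matrix.mul_apply, Fin.sum_univ_three]
    · linear_combination (-b ^ 2 * g 0 ^ 2) * hc
    · linear_combination (-b ^ 2 * g 0 * g 1) * hc
    · linear_combination (-b ^ 2 * g 0 * g 1) * hc
    · linear_combination (-b ^ 2 * g 1 ^ 2) * hc
end
end

section
/- Let r > 1. Let ν₁, ν₂ ∈ ℝ³ be unit vectors with ν_i · e₃ = 0, and set ν_i^⊥ := e₃ × ν_i. Suppose R₁, R₂ ∈ SO(3) satisfy R_i ν_i = r^{−1/2} ν_i + (1 − r^{−1})^{1/2} e₃ and R_i ν_i^⊥ = ν_i^⊥ for i = 1, 2. Set F_i := R_i (ℓ_{ν_i}^{1/2})_{3×2} and F_c := r^{−1/6} I_{3×2}. Then the top 2×2 block (rows 1 and 2) of each F_i equals r^{−1/6} I₂, and consequently, for all λ₁, λ₂, λ₃ ≥ 0 with λ₁ + λ₂ + λ₃ =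 1, the matrix λ₁ F_c + λ₂ F₁ + λ₃ F₂ ∈ ℝ^{3×2} has rank 2. -/
open Matrix

noncomputable section

/-- `R ℓ_ν^{1/2}` has top block `r^{-1/6} I₂`. -/
theorem mul_ellSqrt32_castSucc {r : ℝ} (hr : 0 < r) {v : Fin 3 → ℝ} (hu : unit3 v)
    (hp : v 2 = 0) {R : Matrix (Fin 3) (Fin 3) ℝ} {c : ℝ}
    (ha : R.mulVec v = r ^ (-(1/2) : ℝ) • v + c • (Pi.single 2 1 : Fin 3 → ℝ))
    (hb : R.mulVec ![-v 1, v 0, 0] = ![-v 1, v 0, 0]) (i j : Fin 2) :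
    (R * ellSqrt32 r v) i.castSucc j = r ^ (-(1/6) : ℝ) * (if i = j then 1 else 0) := by
  have hs : r ^ ((1/2) : ℝ) * r ^ (-(1/2) : ℝ) = 1 := by
    rw [← Real.rpow_add hr]; norm_num
  have ha0 := congrFun ha 0
  have ha1 := congrFun ha 1
  have hb0 := congrFun hb 0
  have hb1 := congrFun hb 1
  simp only [unit3, Fin.sum_univ_three, hp] at hu
  simp [mulVec, dotProduct, Fin.sum_univ_three, hp] at ha0 ha1 hb0 hb1
  rw [ellSqrt32, Matrix.mul_smul, Matrix.smul_apply, smul_eq_mul]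
  congr 1
  norm_num at hs ha0 ha1
  generalize r ^ ((1/2) : ℝ) = s at *
  generalize r ^ (-(1/2) : ℝ) = t at *
  fin_cases i <;> fin_cases j <;>
    simp [Matrix.mul_apply, Fin.sum_univ_three, hp]
  · linear_combination s * v 0 * ha0 - v 1 * hb0 + v 0 * v 0 * hs + (1 - R 0 0) * hu
  · linear_combination s * v 1 * ha0 + v 0 * hb0 + v 1 * v 0 * hs - R 0 1 * hu
  · linear_combination s * v 0 * ha1 - v 1 * hb1 + v 0 * v 1 * hs - R 1 0 * hu
  · linear_combination s * v 1 * ha1 + v 0 * hb1 + v 1 * v 1 * hs + (1 - R 1 1) * hu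

/-- A `3 × 2` matrix whose top block is a nonzero multiple of the identity has rank `2`. -/
theorem rank_eq_two_of_castSucc {M : Matrix (Fin 3) (Fin 2) ℝ} {k : ℝ} (hk : k ≠ 0)
    (hM : ∀ i j : Fin 2, M i.castSucc j = k * (if i = j then 1 else 0)) : M.rank = 2 := by
  refine le_antisymm (by simpa using M.rank_le_width) ?_
  have h : M.submatrix Fin.castSucc id = k • (1 : Matrix (Fin 2) (Fin 2) ℝ) := by
    ext i j
    simp [hM, Matrix.one_apply]
  have hrank : (M.submatrix Fin.castSucc id).rank = 2 := by
    rw [h, Matrix.rank_of_isUnit _ ((Matrix.isUnit_iff_isUnit_det _).2 (by simp [hk]))]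
    simp
  exact hrank.symm.le.trans (M.rank_submatrix_le _ _)

/-- for planar unit directors `ν₁, ν₂` (with `ν_i^⊥ = e₃ × ν_i`) and
rotations `R_i` with `R_i ν_i = r^{-1/2} ν_i + (1-r⁻¹)^{1/2} e₃`, `R_i ν_i^⊥ = ν_i^⊥`,
the matrices `F_i = R_i (ℓ_{ν_i}^{1/2})_{3×2}` have top 2×2 block `r^{-1/6} I₂`, and
every convex combination of `F_c = r^{-1/6} I_{3×2}`, `F₁`, `F₂` has rank 2. -/
theorem statement12 (r : ℝ) (hr : 1 < r)
    (ν₁ ν₂ : Fin 3 → ℝ) (hu1 : unit3 ν₁) (hu2 : unit3 ν₂) (hp1 : ν₁ 2 = 0) (hp2 : ν₂ 2 = 0)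
    (R₁ R₂ : Matrix (Fin 3) (Fin 3) ℝ) (hR1 : SO3 R₁) (hR2 : SO3 R₂)
    (ha1 : R₁.mulVec ν₁ = r ^ (-(1/2) : ℝ) • ν₁ + Real.sqrt (1 - r⁻¹) • (Pi.single 2 1 : Fin 3 → ℝ))
    (ha2 : R₂.mulVec ν₂ = r ^ (-(1/2) : ℝ) • ν₂ + Real.sqrt (1 - r⁻¹) • (Pi.single 2 1 : Fin 3 → ℝ))
    (hb1 : R₁.mulVec ![-ν₁ 1, ν₁ 0, 0] = ![-ν₁ 1, ν₁ 0, 0])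
    (hb2 : R₂.mulVec ![-ν₂ 1, ν₂ 0, 0] = ![-ν₂ 1, ν₂ 0, 0])
    (F₁ F₂ Fc : Matrix (Fin 3) (Fin 2) ℝ)
    (hF1 : F₁ = R₁ * ellSqrt32 r ν₁) (hF2 : F₂ = R₂ * ellSqrt32 r ν₂)
    (hFc : Fc = r ^ (-(1/6) : ℝ) •
      Matrix.of (fun (i : Fin 3) (j : Fin 2) => if (i : ℕ) = (j : ℕ) then 1 else 0)) :
    (∀ i j : Fin 2,
      F₁ i.castSucc j = r ^ (-(1/6) : ℝ) * (if i = j then 1 else 0) ∧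
      F₂ i.castSucc j = r ^ (-(1/6) : ℝ) * (if i = j then 1 else 0)) ∧
    (∀ l₁ l₂ l₃ : ℝ, 0 ≤ l₁ → 0 ≤ l₂ → 0 ≤ l₃ → l₁ + l₂ + l₃ = 1 →
      (l₁ • Fc + l₂ • F₁ + l₃ • F₂).rank = 2) := by
  have hr0 : 0 < r := zero_lt_one.trans hr
  have h1 := mul_ellSqrt32_castSucc hr0 hu1 hp1 ha1 hb1
  have h2 := mul_ellSqrt32_castSucc hr0 hu2 hp2 ha2 hb2
  subst hF1 hF2 hFc
  refine ⟨fun i j => ⟨h1 i j, h2 i j⟩, fun l₁ l₂ l₃ _ _ _ hl => ?_⟩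
  refine rank_eq_two_of_castSucc (Real.rpow_pos_of_pos hr0 (-(1/6))).ne' fun i j => ?_
  simp only [Matrix.add_apply, Matrix.smul_apply, smul_eq_mul, h1, h2, Matrix.of_apply,
    Fin.val_castSucc, Fin.val_inj]
  linear_combination (r ^ (-(1/6) : ℝ) * (if i = j then 1 else 0)) * hl
end
end

section
/- Let r ∈ [1, 3]. Define the matrices F₁, F₃, F₄, F₅ ∈ ℝ^{3×2} by: F₁ := r^{−1/6}·[[1, 0], [0, 1], [½√(r−1), (√3/2)√(r−1)]]; F₃ := r^{−1/6}·[[1, 0], [0, 1], [½√(r−1), −(√3/2)√(r−1)]]; F₄ := r^{−1/6}·[[(3−r)/(2r), −(√3/2)(r−1)/r], [−(3√3/2)(r−1)/r, (3−r)/(2r)], [(3−r)√(r−1)/r, √3·√(r−1)/r]]; F₅ := r^{−1/6}·[[(3−r)/(2r), (√3/2)(r−1)/r], [(3√3/2)(r−1)/r, (3−r)/(2r)], [(3−r)√(r−1)/r, −√3·√(r−1)/r]] (rows listed top to bottom). Set F_a := r^{−1/6} I_{3×2}. Then for each of the three pairs (A, B) ∈ {(F₁, F₄), (F₃, F₅),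 (F₁, F₃)} and all λ₁, λ₂, λ₃ ≥ 0 with λ₁ + λ₂ + λ₃ = 1, the matrix λ₁ F_a + λ₂ A + λ₃ B has rank 2. -/
open Matrix

noncomputable section

/-- Deformation gradient `F₁` of the box design. -/
def F1 (r : ℝ) : Matrix (Fin 3) (Fin 2) ℝ :=
  r ^ (-(1/6) : ℝ) • !![(1 : ℝ), 0; 0, 1;
    Real.sqrt (r - 1) / 2, Real.sqrt 3 / 2 * Real.sqrt (r - 1)]

/-- Deformation gradient `F₃` of the box design. -/
def F3 (r : ℝ) : Matrix (Fin 3) (Fin 2) ℝ :=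
  r ^ (-(1/6) : ℝ) • !![(1 : ℝ), 0; 0, 1;
    Real.sqrt (r - 1) / 2, -(Real.sqrt 3 / 2 * Real.sqrt (r - 1))]

/-- Deformation gradient `F₄` of the box design. -/
def F4 (r : ℝ) : Matrix (Fin 3) (Fin 2) ℝ :=
  r ^ (-(1/6) : ℝ) • !![(3 - r) / (2 * r), -(Real.sqrt 3 / 2 * ((r - 1) / r));
    -(3 * Real.sqrt 3 / 2 * ((r - 1) / r)), (3 - r) / (2 * r);
    (3 - r) * Real.sqrt (r - 1) / r, Real.sqrt 3 * Real.sqrt (r - 1) / r]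

/-- Deformation gradient `F₅` of the box design. -/
def F5 (r : ℝ) : Matrix (Fin 3) (Fin 2) ℝ :=
  r ^ (-(1/6) : ℝ) • !![(3 - r) / (2 * r), Real.sqrt 3 / 2 * ((r - 1) / r);
    3 * Real.sqrt 3 / 2 * ((r - 1) / r), (3 - r) / (2 * r);
    (3 - r) * Real.sqrt (r - 1) / r, -(Real.sqrt 3 * Real.sqrt (r - 1) / r)]

/-- The auxiliary matrix `F_a = r^{-1/6} I_{3×2}`. -/
def Fa (r : ℝ) : Matrix (Fin 3) (Fin 2) ℝ :=
  r ^ (-(1/6) : ℝ) •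
    Matrix.of (fun (i : Fin 3) (j : Fin 2) => if (i : ℕ) = (j : ℕ) then 1 else 0)

theorem Fa_eq (r : ℝ) : Fa r = r ^ (-(1/6) : ℝ) • !![1, 0; 0, 1; 0, 0] := by
  ext i j
  fin_cases i <;> fin_cases j <;> simp [Fa]

theorem rank_smul_eq_two_of_minor_ne_zero {k a b c d e f : ℝ} (hk : k ≠ 0)
    (h : a * d - b * c ≠ 0 ∨ a * f - b * e ≠ 0) :
    (k • !![a, b; c, d; e, f]).rank = 2 := by
  rw [← rank_transpose]
  have hli : LinearIndependent ℝ (k • !![a, b; c, d; e, f])ᵀ.row := by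
    rw [Fintype.linearIndependent_iff]
    intro g hst
    rw [Fin.sum_univ_two] at hst
    rw [Fin.forall_fin_two]
    generalize g 0 = s at hst ⊢
    generalize g 1 = t at hst ⊢
    have h0 := congrFun hst 0
    have h1 := congrFun hst 1
    have h2 := congrFun hst 2
    simp at h0 h1 h2
    replace h0 : s * a + t * b = 0 := mul_left_cancel₀ hk (by linear_combination h0)
    replace h1 : s * c + t * d = 0 := mul_left_cancel₀ hk (by linear_combination h1)
    replace h2 : s * e + t * f = 0 := mul_left_cancel₀ hk (by linear_combination h2)
    rcases h with h | h
    · exact ⟨mul_right_cancel₀ h (by linear_combination d * h0 - b * h1),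
        mul_right_cancel₀ h (by linear_combination a * h1 - c * h0)⟩
    · exact ⟨mul_right_cancel₀ h (by linear_combination f * h0 - b * h2),
        mul_right_cancel₀ h (by linear_combination a * h2 - e * h0)⟩
  simpa using hli.rank_matrix

/-- The common form of the combinations of `(F₁, F₄)` (with `σ = 1`) and `(F₃, F₅)` (with
`σ = -1`): if the upper minor `1 - 3 * x` vanishes, the minor of the first and third rows
does not. -/
theorem rank_smul_eq_two_of_sign {k σ x u v : ℝ} (hk : k ≠ 0) (hσ : σ ^ 2 = 1)
    (hu : 0 ≤ u) (hv : x = 1 / 3 → 0 < v) :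
    (k • !![1 - 3 / 2 * x, -(σ * (√3 / 2 * x)); -(σ * (3 * √3 / 2 * x)), 1 - 3 / 2 * x;
      u, σ * v]).rank = 2 := by
  have h3 : √3 ^ 2 = 3 := Real.sq_sqrt (by norm_num)
  apply rank_smul_eq_two_of_minor_ne_zero hk
  by_cases hx : x = 1 / 3
  · right
    have hpos : 0 < v / 2 + √3 / 6 * u := by
      have := hv hx
      positivity
    have hσ0 : σ ≠ 0 := by
      rintro rfl
      norm_num at hσ
    have heq : (1 - 3 / 2 * x) * (σ * v) - -(σ * (√3 / 2 * x)) * u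
        = σ * (v / 2 + √3 / 6 * u) := by
      rw [hx]
      ring
    rw [heq]
    exact mul_ne_zero hσ0 hpos.ne'
  · left
    intro h
    apply hx
    linear_combination -h / 3 - (x ^ 2 / 4) * (σ ^ 2 * h3 + 3 * hσ)

/-- for `r ∈ [1,3]` and each pair `(A,B) ∈ {(F₁,F₄),(F₃,F₅),(F₁,F₃)}`,
every convex combination `λ₁ F_a + λ₂ A + λ₃ B` has rank 2. -/
theorem statement13 (r : ℝ) (hr1 : 1 ≤ r) (hr3 : r ≤ 3) :
    ∀ A B : Matrix (Fin 3) (Fin 2) ℝ,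
      ((A = F1 r ∧ B = F4 r) ∨ (A = F3 r ∧ B = F5 r) ∨ (A = F1 r ∧ B = F3 r)) →
      ∀ l₁ l₂ l₃ : ℝ, 0 ≤ l₁ → 0 ≤ l₂ → 0 ≤ l₃ → l₁ + l₂ + l₃ = 1 →
        (l₁ • Fa r + l₂ • A + l₃ • B).rank = 2 := by
  intro A B hAB l₁ l₂ l₃ _ h2 h3 hsum
  have hr : 0 < r := by linarith
  have hk : r ^ (-(1/6) : ℝ) ≠ 0 := (Real.rpow_pos_of_pos hr _).ne'
  obtain rfl : l₁ = 1 - l₂ - l₃ := by linarith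
  have hu : 0 ≤ √(r - 1) * (l₂ / 2 + l₃ * ((3 - r) / r)) := by
    have : 0 ≤ 3 - r := by linarith
    positivity
  have hv : l₃ * ((r - 1) / r) = 1 / 3 → 0 < √3 * √(r - 1) * (l₂ / 2 + l₃ / r) := by
    intro h
    have hl : 0 < l₃ := h3.lt_of_ne (by rintro rfl; norm_num at h)
    have hq : 0 < √(r - 1) := by
      apply Real.sqrt_pos.2
      apply (sub_nonneg.2 hr1).lt_of_ne
      intro h'
      rw [← h'] at h
      norm_num at h
    positivity
  rcases hAB with ⟨rfl, rfl⟩ | ⟨rfl, rfl⟩ | ⟨rfl, rfl⟩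
  · convert rank_smul_eq_two_of_sign (σ := 1) hk (by norm_num) hu hv using 2
    ext i j
    fin_cases i <;> fin_cases j <;> simp [Fa_eq, F1, F4] <;> field_simp <;> ring
  · convert rank_smul_eq_two_of_sign (σ := -1) hk (by norm_num) hu hv using 2
    ext i j
    fin_cases i <;> fin_cases j <;> simp [Fa_eq, F3, F5] <;> field_simp <;> ring
  · have heq : (1 - l₂ - l₃) • Fa r + l₂ • F1 r + l₃ • F3 r
        = r ^ (-(1/6) : ℝ) • !![1, 0; 0, 1; (l₂ + l₃) * (√(r - 1) / 2),
          (l₂ - l₃) * (√3 / 2 * √(r - 1))] := by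
      ext i j
      fin_cases i <;> fin_cases j <;> simp [Fa_eq, F1, F3] <;> ring
    rw [heq]
    exact rank_smul_eq_two_of_minor_ne_zero hk (Or.inl (by norm_num))
end
end

section
/- Let c₁, c₂ > 0, c₃ ∈ (0, 1], c₄ ∈ [0, (1−c₃)/c₂], and let σ₁, σ₂ ≥ 0 with σ₁ ≠ σ₂. For s ∈ [−c₂, c₂] define σ(s, ·) : [−1, 1] → ℝ by σ(s, t) := σ₁ if t < c₄s and σ(s, t) := σ₂ if t ≥ c₄s. For h > 0 and u : [−1, 1] → ℝ define the Modica–Mortola-type functional I^h_s(u) := ∫_{−1}^{1} (1/h)·[ (u(t)² − σ(s, t))² + c₁ h · u′(t)² ] dt. Then there exist constants c_L > 0 and h₀ ∈ (0, 1], depending only on c₁, c₂, c₃, c₄, σ₁, σ₂, such that for every h ∈ (0, h₀), every s ∈ [−c₂, c₂], and every continuously differentiable function u : [−1, 1] → ℝ with u(t) ≥ 0 for all t, one has I^h_s(u) ≥ c_L. -/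
open MeasureTheory

/-- A lower bound for a nonnegative integrand on a subinterval bounds the whole integral. -/
theorem integral_le_integral_of_subinterval {F G : ℝ → ℝ} {A B a b : ℝ}
    (hF : IntervalIntegrable F volume A B) (hF0 : ∀ t, 0 ≤ F t)
    (hAa : A ≤ a) (hab : a ≤ b) (hbB : b ≤ B) (hG : IntervalIntegrable G volume a b)
    (hGF : ∀ t ∈ Set.Ioo a b, G t ≤ F t) :
    ∫ t in a..b, G t ≤ ∫ t in A..B, F t := by
  have hsub : IntervalIntegrable F volume a b := by
    refine hF.mono_set ?_
    rw [Set.uIcc_of_le hab, Set.uIcc_of_le (hAa.trans (hab.trans hbB))]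
    exact Set.Icc_subset_Icc hAa hbB
  exact (intervalIntegral.integral_mono_on_of_le_Ioo hab hG hsub hGF).trans
    (intervalIntegral.integral_mono_interval hAa hab hbB
      (Filter.Eventually.of_forall hF0) hF)

/-- A nonnegative integrand with small integral dips below a threshold on a long subinterval. -/
theorem exists_lt_of_integral_lt {F : ℝ → ℝ} {A B a b l m : ℝ}
    (hF : IntervalIntegrable F volume A B) (hF0 : ∀ t, 0 ≤ F t)
    (hAa : A ≤ a) (hab : a ≤ b) (hbB : b ≤ B) (hl : l ≤ b - a) (hm : 0 ≤ m)
    (hlt : ∫ t in A..B, F t < l * m) : ∃ t ∈ Set.Ioo a b, F t < m := by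
  by_contra! H
  have h := integral_le_integral_of_subinterval hF hF0 hAa hab hbB
    (intervalIntegrable_const (c := m)) H
  rw [intervalIntegral.integral_const, smul_eq_mul] at h
  nlinarith

/-- On an interval of length at most two, the squared increment of a `C¹` function is
controlled by its Dirichlet energy. -/
theorem sq_sub_le_of_mul_sq_deriv_le {F u u' : ℝ → ℝ} {c A B a b : ℝ} (hc : 0 ≤ c)
    (hF : IntervalIntegrable F volume A B) (hF0 : ∀ t, 0 ≤ F t)
    (hAa : A ≤ a) (hab : a ≤ b) (hbB : b ≤ B) (hlen : b - a ≤ 2)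
    (hu' : ContinuousOn u' (Set.Icc A B))
    (hu : ∀ t ∈ Set.Icc A B, HasDerivWithinAt u (u' t) (Set.Icc A B) t)
    (hle : ∀ t, c * u' t ^ 2 ≤ F t) :
    c * (u b - u a) ^ 2 ≤ 2 * ∫ t in A..B, F t := by
  have hsub : Set.Icc a b ⊆ Set.Icc A B := Set.Icc_subset_Icc hAa hbB
  have hint : IntervalIntegrable u' volume a b :=
    (hu'.mono hsub).intervalIntegrable_of_Icc hab
  have hftc : ∫ t in a..b, u' t = u b - u a := by
    refine intervalIntegral.integral_eq_sub_of_hasDerivAt_of_le hab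
      (fun t ht => ((hu t (hsub ht)).mono hsub).continuousWithinAt) (fun t ht => ?_) hint
    exact (hu t (hsub (Set.Ioo_subset_Icc_self ht))).hasDerivAt
      (Icc_mem_nhds (hAa.trans_lt ht.1) (ht.2.trans_le hbB))
  set k := (u b - u a) / 2 with hk
  have hG : IntervalIntegrable (fun t => c * (2 * k * u' t - k ^ 2)) volume a b :=
    ((hint.const_mul _).sub intervalIntegrable_const).const_mul _
  have h := integral_le_integral_of_subinterval hF hF0 hAa hab hbB hG fun t _ =>
    (mul_le_mul_of_nonneg_left (by nlinarith [sq_nonneg (u' t - k)]) hc).trans (hle t)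
  rw [intervalIntegral.integral_const_mul,
    intervalIntegral.integral_sub (hint.const_mul _) intervalIntegrable_const,
    intervalIntegral.integral_const_mul, hftc, intervalIntegral.integral_const,
    smul_eq_mul] at h
  have hd : u b - u a = 2 * k := by rw [hk]; ring
  rw [hd] at h ⊢
  nlinarith [mul_nonneg (mul_nonneg hc (sq_nonneg k)) (sub_nonneg.2 hlen)]

/-- Two numbers whose squares are close to different wells are a definite distance apart. -/
theorem sq_sub_le_mul_sq_sub_of_near_wells {σ₁ σ₂ x y : ℝ} (hσ₁ : 0 ≤ σ₁) (hσ₂ : 0 ≤ σ₂)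
    (hx : (x ^ 2 - σ₁) ^ 2 < (σ₁ - σ₂) ^ 2 / 16)
    (hy : (y ^ 2 - σ₂) ^ 2 < (σ₁ - σ₂) ^ 2 / 16) :
    (σ₁ - σ₂) ^ 2 ≤ 32 * (σ₁ + σ₂) * (y - x) ^ 2 := by
  have h16 : (σ₁ - σ₂) ^ 2 / 16 = (|σ₁ - σ₂| / 4) ^ 2 := by rw [div_pow, sq_abs]; norm_num
  have hδ : 0 ≤ |σ₁ - σ₂| := abs_nonneg _
  have hδle : |σ₁ - σ₂| ≤ σ₁ + σ₂ := abs_le.2 ⟨by linarith, by linarith⟩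
  rw [h16] at hx hy
  obtain ⟨hx₁, hx₂⟩ := abs_lt.1 (abs_lt_of_sq_lt_sq hx (by positivity))
  obtain ⟨hy₁, hy₂⟩ := abs_lt.1 (abs_lt_of_sq_lt_sq hy (by positivity))
  have hdiff : |σ₁ - σ₂| / 2 ≤ |y ^ 2 - x ^ 2| := by
    rcases abs_cases (σ₁ - σ₂) with h | h <;> rcases abs_cases (y ^ 2 - x ^ 2) with h' | h' <;>
      linarith
  have hsq : (σ₁ - σ₂) ^ 2 ≤ 4 * (y ^ 2 - x ^ 2) ^ 2 := by
    rw [← sq_abs (σ₁ - σ₂), ← sq_abs (y ^ 2 - x ^ 2)]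
    nlinarith
  have hsum : (y + x) ^ 2 ≤ 4 * (σ₁ + σ₂) := by
    nlinarith [sq_nonneg (y - x)]
  calc (σ₁ - σ₂) ^ 2 ≤ 4 * (y ^ 2 - x ^ 2) ^ 2 := hsq
    _ = 4 * ((y + x) ^ 2 * (y - x) ^ 2) := by ring
    _ ≤ 4 * (4 * (σ₁ + σ₂) * (y - x) ^ 2) := by gcongr
    _ ≤ 32 * (σ₁ + σ₂) * (y - x) ^ 2 := by
      nlinarith [mul_nonneg (add_nonneg hσ₁ hσ₂) (sq_nonneg (y - x))]

/-- Modica–Mortola-type lower bound: with `σ(s,t) = σ₁` for `t < c₄ s`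
and `σ₂` for `t ≥ c₄ s`, there are `c_L > 0` and `h₀ ∈ (0,1]` such that for all
`h ∈ (0,h₀)`, all `s ∈ [-c₂,c₂]` and every nonnegative continuously differentiable
`u : [-1,1] → ℝ` (with derivative `u'`),
`∫_{-1}^{1} (1/h)[(u² - σ(s,t))² + c₁ h (u')²] dt ≥ c_L`. -/
theorem statement15 (c₁ c₂ c₃ c₄ σ₁ σ₂ : ℝ)
    (hc₁ : 0 < c₁) (hc₂ : 0 < c₂) (hc₃ : 0 < c₃) (hc₃' : c₃ ≤ 1)
    (hc₄ : 0 ≤ c₄) (hc₄' : c₄ ≤ (1 - c₃) / c₂)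
    (hσ₁ : 0 ≤ σ₁) (hσ₂ : 0 ≤ σ₂) (hσ : σ₁ ≠ σ₂) :
    ∃ cL : ℝ, 0 < cL ∧ ∃ h₀ : ℝ, 0 < h₀ ∧ h₀ ≤ 1 ∧
      ∀ h : ℝ, 0 < h → h < h₀ → ∀ s : ℝ, |s| ≤ c₂ →
        ∀ u u' : ℝ → ℝ,
          ContinuousOn u' (Set.Icc (-1 : ℝ) 1) →
          (∀ t ∈ Set.Icc (-1 : ℝ) 1, HasDerivWithinAt u (u' t) (Set.Icc (-1 : ℝ) 1) t) →
          (∀ t ∈ Set.Icc (-1 : ℝ) 1, 0 ≤ u t) →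
          cL ≤ ∫ t in (-1 : ℝ)..1,
            (1 / h) * (((u t) ^ 2 - (if t < c₄ * s then σ₁ else σ₂)) ^ 2
              + c₁ * h * (u' t) ^ 2) := by
  have hδ : 0 < (σ₁ - σ₂) ^ 2 := sq_pos_of_ne_zero (sub_ne_zero.2 hσ)
  have hM : 0 < σ₁ + σ₂ := by
    rcases hσ₁.eq_or_lt with h | h
    · rcases hσ₂.eq_or_lt with h' | h'
      · exact absurd (h.symm.trans h') hσ
      · linarith
    · linarith
  refine ⟨min (c₃ * ((σ₁ - σ₂) ^ 2 / 16)) (c₁ * (σ₁ - σ₂) ^ 2 / (64 * (σ₁ + σ₂))),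
    lt_min (by positivity) (by positivity), 1, one_pos, le_rfl, ?_⟩
  intro h hh hh₁ s hs u u' hu' hu _
  have hp : |c₄ * s| ≤ 1 - c₃ := by
    rw [abs_mul, abs_of_nonneg hc₄]
    exact (mul_le_mul_of_nonneg_left hs hc₄).trans ((le_div_iff₀ hc₂).1 hc₄')
  obtain ⟨hp₁, hp₂⟩ := abs_le.1 hp
  set p := c₄ * s
  set F : ℝ → ℝ := fun t => (1 / h) * (((u t) ^ 2 - (if t < p then σ₁ else σ₂)) ^ 2
    + c₁ * h * (u' t) ^ 2) with hF
  have hwell : ∀ t, ((u t) ^ 2 - (if t < p then σ₁ else σ₂)) ^ 2 ≤ F t := fun t => by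
    have h1 : 1 ≤ 1 / h := (one_le_div hh).2 hh₁.le
    have h2 : 0 ≤ c₁ * h * (u' t) ^ 2 := by positivity
    exact (le_add_of_nonneg_right h2).trans
      (le_mul_of_one_le_left (add_nonneg (sq_nonneg _) h2) h1)
  have hgrad : ∀ t, c₁ * (u' t) ^ 2 ≤ F t := fun t => by
    have h1 : F t = (1 / h) * ((u t) ^ 2 - (if t < p then σ₁ else σ₂)) ^ 2
        + c₁ * (u' t) ^ 2 := by
      simp only [hF]
      field_simp
    rw [h1]
    exact le_add_of_nonneg_left (by positivity)
  have hF0 : ∀ t, 0 ≤ F t := fun t => (sq_nonneg _).trans (hwell t)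
  have huc : ContinuousOn u (Set.Icc (-1) 1) := fun t ht => (hu t ht).continuousWithinAt
  have hFint : IntervalIntegrable F volume (-1) 1 := by
    have hcont : ∀ σ : ℝ, IntegrableOn (fun t => (1 / h) * (((u t) ^ 2 - σ) ^ 2
        + c₁ * h * (u' t) ^ 2)) (Set.Icc (-1) 1) := fun σ =>
      ContinuousOn.integrableOn_Icc (by fun_prop)
    rw [intervalIntegrable_iff_integrableOn_Icc_of_le (by norm_num)]
    have := Integrable.piecewise (measurableSet_Iio (a := p))
      (hcont σ₁).integrableOn (hcont σ₂).integrableOn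
    refine this.congr (Filter.Eventually.of_forall fun t => ?_)
    by_cases ht : t < p <;> simp [hF, Set.piecewise, ht]
  by_contra! hlt
  obtain ⟨hlt₁, hlt₂⟩ := lt_min_iff.1 hlt
  obtain ⟨t₁, ht₁, hw₁⟩ := exists_lt_of_integral_lt (a := -1) (b := p) hFint hF0
    le_rfl (by linarith) (by linarith) (by linarith) (by positivity) hlt₁
  obtain ⟨t₂, ht₂, hw₂⟩ := exists_lt_of_integral_lt (a := p) (b := 1) hFint hF0
    (by linarith) (by linarith) le_rfl (by linarith) (by positivity) hlt₁
  have hx := (hwell t₁).trans_lt hw₁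
  have hy := (hwell t₂).trans_lt hw₂
  rw [if_pos ht₁.2] at hx
  rw [if_neg ht₂.1.le.not_gt] at hy
  have hsep := sq_sub_le_mul_sq_sub_of_near_wells hσ₁ hσ₂ hx hy
  have hinc := sq_sub_le_of_mul_sq_deriv_le hc₁.le hFint hF0 ht₁.1.le
    (ht₁.2.trans ht₂.1).le ht₂.2.le (by linarith [ht₁.1, ht₂.2]) hu' hu hgrad
  rw [lt_div_iff₀ (by positivity)] at hlt₂
  have h1 := mul_le_mul_of_nonneg_left hsep hc₁.le
  have h2 := mul_le_mul_of_nonneg_left hinc (mul_nonneg (by norm_num : (0 : ℝ) ≤ 32) hM.le)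
  linarith
end
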